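/- Let χ be a character of T of minimal depth r. Then for every integer d ≥ r+1 there is a K-invariant subspace W_d of V_χ^{K_{d+1}} with V_χ^{K_{d+1}} = V_χ^{K_d} ⊕ W_d, and each such W_d is an irreducible K-representation of dimension (q²−1)·q^{d−1} on which K_{d+1} acts trivially but K_d does not; consequently ⋃_{n ≥ r+1} V_χ^{K_n} = V_χ^{K_{r+1}} ⊕ ⊕_{d ≥ r+1} W_d. Moreover, if χ is nontrivial on O_F^×, then V_χ^{K_{r+1}} is an irreducible K-representation of dimension (q+1)·q^r. -/

import Mathlib

open Matrix

noncomputable section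

/-- A 2×2 matrix over `E`. -/
abbrev Mat (E : Type) := Matrix (Fin 2) (Fin 2) E

/-- The context: `E/F` is the unramified quadratic extension of a finite extension `F` of
`ℚ_p` (`p` odd), encoded via the Galois involution `sig` (whose fixed field is `F`),
the valuation `nu` (normalized by `nu ϖ = 1` for a uniformizer `ϖ` of `F`),
a square root `sqeps` of a non-square unit `eps = sqeps^2` of `O_F`, the residue-field
cardinality `q` of `F`, and an additive character `psi'` of `F` trivial on `p_F` and
nontrivial on `O_F`. -/
structure USetting (E : Type) [Field E] where
  sig : E →+* E
  nu : E → WithTop ℤ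
  sqeps : E
  pi : E
  q : ℕ
  psi' : E → ℂ
  sig_invol : ∀ x, sig (sig x) = x
  sig_ne : ∃ x, sig x ≠ x
  nu_eq_top : ∀ x, nu x = ⊤ ↔ x = 0
  nu_mul : ∀ x y, nu (x * y) = nu x + nu y
  nu_add : ∀ x y, min (nu x) (nu y) ≤ nu (x + y)
  nu_sig : ∀ x, nu (sig x) = nu x
  nu_pi : nu pi = 1
  sig_pi : sig pi = pi
  sig_sqeps : sig sqeps = - sqeps
  nu_sqeps : nu sqeps = 0
  eps_not_square : ∀ y, sig y = y → y * y ≠ sqeps * sqeps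
  gen : ∀ x : E, ∃ a b, sig a = a ∧ sig b = b ∧ x = a + b * sqeps
  nu_two : nu 2 = 0
  charzero : ∀ n : ℕ, (n : E) = 0 → n = 0
  complete : ∀ f : ℕ → E, (∀ n : ℕ, ((n : ℤ) : WithTop ℤ) ≤ nu (f (n + 1) - f n)) →
    ∃ L, ∀ n : ℕ, ((n : ℤ) : WithTop ℤ) ≤ nu (L - f n)
  res_card : ∃ R : Finset E, R.card = q ∧ (∀ x ∈ R, sig x = x ∧ 0 ≤ nu x) ∧
    ∀ y : E, sig y = y → 0 ≤ nu y → ∃! x, x ∈ R ∧ 1 ≤ nu (y - x)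
  psi'_mul : ∀ x y, sig x = x → sig y = y → psi' (x + y) = psi' x * psi' y
  psi'_ne : ∀ x, sig x = x → psi' x ≠ 0
  psi'_triv : ∀ x, sig x = x → 1 ≤ nu x → psi' x = 1
  psi'_nontriv : ∃ x, sig x = x ∧ 0 ≤ nu x ∧ psi' x ≠ 1

variable {E : Type} [Field E]

/-- The matrix `w₀ = [[0,1],[1,0]]`. -/
def w0 (E : Type) [Field E] : Mat E := !![0, 1; 1, 0]

/-- `G = U(1,1)(F)`. -/
def Gset (S : USetting E) : Set (Mat E) :=
  {g | (g.map ⇑S.sig)ᵀ * w0 E * g = w0 E}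

/-- `K = G ∩ GL₂(O_E)`: entries in `O_E` and determinant in `O_E^×`. -/
def Kset (S : USetting E) : Set (Mat E) :=
  {g | g ∈ Gset S ∧ (∀ i j, 0 ≤ S.nu (g i j)) ∧ S.nu g.det = 0}

/-- The congruence filtration subgroup `K_n` (for `n ≥ 1`; `K_0 = K` as a set). -/
def Kfil (S : USetting E) (n : ℤ) : Set (Mat E) :=
  {g | g ∈ Kset S ∧ ∀ i j, (n : WithTop ℤ) ≤ S.nu ((g - 1) i j)}

/-- `𝓑 = B ∩ K`, the upper triangular matrices in `K`. -/
def Bcal (S : USetting E) : Set (Mat E) := {g | g ∈ Kset S ∧ g 1 0 = 0}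

/-- `E^1`, the norm-one elements of `E`. -/
def E1set (S : USetting E) : Set E := {x | x * S.sig x = 1}

/-- `O_F^×` as a subset of `E`. -/
def OFunits (S : USetting E) : Set E := {x | S.sig x = x ∧ S.nu x = 0}

/-- `O_E^×` as a subset of `E`. -/
def OEunits (S : USetting E) : Set E := {x | S.nu x = 0}

/-- A character of `E^×`, encoded as a function `E → ℂ` multiplicative and
nonvanishing on nonzero elements. -/
def IsChar (χ : E → ℂ) : Prop :=
  (∀ x y : E, x ≠ 0 → y ≠ 0 → χ (x * y) = χ x * χ y) ∧ ∀ x : E, x ≠ 0 → χ x ≠ 0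

/-- A group homomorphism `E^1 → ℂ^×`, encoded as a function `E → ℂ`. -/
def IsE1Hom (S : USetting E) (φ : E → ℂ) : Prop :=
  (∀ x ∈ E1set S, ∀ y ∈ E1set S, φ (x * y) = φ x * φ y) ∧ ∀ x ∈ E1set S, φ x ≠ 0

/-- A homomorphism into `ℂ^×` on a subset of matrices. -/
def IsHomOn (A : Set (Mat E)) (Ψ : Mat E → ℂ) : Prop :=
  (∀ x ∈ A, ∀ y ∈ A, Ψ (x * y) = Ψ x * Ψ y) ∧ ∀ x ∈ A, Ψ x ≠ 0

/-- `1 + p_E^n`. -/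
def onePE (S : USetting E) (n : ℤ) : Set E := {x | (n : WithTop ℤ) ≤ S.nu (x - 1)}

/-- `1 + p_F^n`. -/
def onePF (S : USetting E) (n : ℤ) : Set E :=
  {x | S.sig x = x ∧ (n : WithTop ℤ) ≤ S.nu (x - 1)}

/-- `χ` is trivial on a set. -/
def TrivOn (χ : E → ℂ) (s : Set E) : Prop := ∀ x ∈ s, χ x = 1

/-- `χ` has depth `r`: trivial on `1+p_E^{r+1}` and (if `r ≥ 1`) nontrivial on `1+p_E^r`. -/
def HasDepth (S : USetting E) (χ : E → ℂ) (r : ℕ) : Prop :=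
  TrivOn χ (onePE S ((r : ℤ) + 1)) ∧ (r = 0 ∨ ¬ TrivOn χ (onePE S (r : ℤ)))

/-- `χ` has true depth `r`: the depth of its restriction to `F^×` is `r`. -/
def HasTrueDepth (S : USetting E) (χ : E → ℂ) (r : ℕ) : Prop :=
  TrivOn χ (onePF S ((r : ℤ) + 1)) ∧ (r = 0 ∨ ¬ TrivOn χ (onePF S (r : ℤ)))

/-- `χ` has minimal depth `r`: its depth and true depth both equal `r`. -/
def MinDepth (S : USetting E) (χ : E → ℂ) (r : ℕ) : Prop :=
  HasDepth S χ r ∧ HasTrueDepth S χ r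

/-- Right translation action on functions. -/
def rho (g : Mat E) : (Mat E → ℂ) →ₗ[ℂ] (Mat E → ℂ) where
  toFun f := fun k => f (k * g)
  map_add' _ _ := rfl
  map_smul' _ _ := rfl

/-- The space `V_χ^{K_n}`: functions on `K` (extended by zero off `K`) satisfying
`f(bk) = χ(b₁₁) f(k)` for `b ∈ 𝓑` and right `K_n`-invariance. -/
def Vsp (S : USetting E) (χ : E → ℂ) (n : ℤ) : Submodule ℂ (Mat E → ℂ) where
  carrier := {f | (∀ x, x ∉ Kset S → f x = 0) ∧
    (∀ b ∈ Bcal S, ∀ k ∈ Kset S, f (b * k) = χ (b 0 0) * f k) ∧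
    (∀ k ∈ Kset S, ∀ g ∈ Kfil S n, f (k * g) = f k)}
  add_mem' := by
    rintro f g ⟨hf0, hf1, hf2⟩ ⟨hg0, hg1, hg2⟩
    refine ⟨fun x hx => ?_, fun b hb k hk => ?_, fun k hk g' hg' => ?_⟩
    · simp [hf0 x hx, hg0 x hx]
    · simp only [Pi.add_apply, hf1 b hb k hk, hg1 b hb k hk]; ring
    · simp only [Pi.add_apply, hf2 k hk g' hg', hg2 k hk g' hg']
  zero_mem' := by
    refine ⟨fun x _ => rfl, fun b _ k _ => by simp, fun k _ g _ => rfl⟩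
  smul_mem' := by
    rintro c f ⟨hf0, hf1, hf2⟩
    refine ⟨fun x hx => ?_, fun b hb k hk => ?_, fun k hk g' hg' => ?_⟩
    · simp [hf0 x hx]
    · simp only [Pi.smul_apply, hf1 b hb k hk, smul_eq_mul]; ring
    · simp only [Pi.smul_apply, hf2 k hk g' hg']

/-- The space of the representation induced from a character `Ψ` of a subgroup `H ⊆ K`:
functions on `K` (extended by zero) with `f(hk) = Ψ(h) f(k)`. -/
def IndSp (S : USetting E) (H : Set (Mat E)) (Ψ : Mat E → ℂ) : Submodule ℂ (Mat E → ℂ) where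
  carrier := {f | (∀ x, x ∉ Kset S → f x = 0) ∧
    ∀ h ∈ H, ∀ k ∈ Kset S, f (h * k) = Ψ h * f k}
  add_mem' := by
    rintro f g ⟨hf0, hf1⟩ ⟨hg0, hg1⟩
    refine ⟨fun x hx => ?_, fun h hh k hk => ?_⟩
    · simp [hf0 x hx, hg0 x hx]
    · simp only [Pi.add_apply, hf1 h hh k hk, hg1 h hh k hk]; ring
  zero_mem' := ⟨fun x _ => rfl, fun h _ k _ => by simp⟩
  smul_mem' := by
    rintro c f ⟨hf0, hf1⟩
    refine ⟨fun x hx => ?_, fun h hh k hk => ?_⟩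
    · simp [hf0 x hx]
    · simp only [Pi.smul_apply, hf1 h hh k hk, smul_eq_mul]; ring

/-- The functions constant on `K` and zero off `K`. -/
def ConstSub (S : USetting E) : Submodule ℂ (Mat E → ℂ) where
  carrier := {f | (∀ x, x ∉ Kset S → f x = 0) ∧ ∃ c : ℂ, ∀ k ∈ Kset S, f k = c}
  add_mem' := by
    rintro f g ⟨hf0, c, hc⟩ ⟨hg0, c', hc'⟩
    exact ⟨fun x hx => by simp [hf0 x hx, hg0 x hx],
      c + c', fun k hk => by simp [hc k hk, hc' k hk]⟩
  zero_mem' := ⟨fun x _ => rfl, 0, fun _ _ => rfl⟩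
  smul_mem' := by
    rintro a f ⟨hf0, c, hc⟩
    exact ⟨fun x hx => by simp [hf0 x hx], a * c, fun k hk => by simp [hc k hk]⟩

/-- A subspace is `K`-invariant. -/
def KInvariant (S : USetting E) (W : Submodule ℂ (Mat E → ℂ)) : Prop :=
  ∀ g ∈ Kset S, ∀ f ∈ W, rho g f ∈ W

/-- A subset `A ⊆ K` acts trivially on `W`. -/
def ActsTrivially (S : USetting E) (A : Set (Mat E)) (W : Submodule ℂ (Mat E → ℂ)) : Prop :=
  ∀ g ∈ A, ∀ f ∈ W, rho g f = f

/-- `W` is an irreducible representation of `K`. -/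
def IsIrredRep (S : USetting E) (W : Submodule ℂ (Mat E → ℂ)) : Prop :=
  W ≠ ⊥ ∧ KInvariant S W ∧
    ∀ U : Submodule ℂ (Mat E → ℂ), U ≤ W → KInvariant S U → U = ⊥ ∨ U = W

/-- `V` and `W` are isomorphic as representations of `K`. -/
def RepIso (S : USetting E) (V W : Submodule ℂ (Mat E → ℂ)) : Prop :=
  ∃ e : (Mat E → ℂ) →ₗ[ℂ] (Mat E → ℂ), Set.BijOn ⇑e ↑V ↑W ∧
    ∀ g ∈ Kset S, ∀ f ∈ V, e (rho g f) = rho g (e f)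

/-- The space of `ℂ`-linear endomorphisms of `V` commuting with the right-translation
action of `K`, realized inside the function space `↥V → ↥V`. -/
def Commutant (S : USetting E) (V : Submodule ℂ (Mat E → ℂ)) :
    Submodule ℂ (↥V → ↥V) where
  carrier := {T | (∀ x y : ↥V, T (x + y) = T x + T y) ∧
    (∀ (c : ℂ) (x : ↥V), T (c • x) = c • T x) ∧
    ∀ g ∈ Kset S, ∀ f : ↥V, ∀ h : rho g (f : Mat E → ℂ) ∈ V,
      ((T ⟨rho g (f : Mat E → ℂ), h⟩ : ↥V) : Mat E → ℂ) = rho g ((T f : ↥V) : Mat E → ℂ)}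
  add_mem' := by
    rintro T T' ⟨hT1, hT2, hT3⟩ ⟨hT1', hT2', hT3'⟩
    refine ⟨fun x y => ?_, fun c x => ?_, fun g hg f h => ?_⟩
    · simp only [Pi.add_apply, hT1 x y, hT1' x y]; abel
    · simp only [Pi.add_apply, hT2 c x, hT2' c x, smul_add]
    · simp only [Pi.add_apply, Submodule.coe_add, hT3 g hg f h, hT3' g hg f h, map_add]
  zero_mem' := by
    refine ⟨fun x y => by simp, fun c x => by simp, fun g hg f h => by simp⟩
  smul_mem' := by
    rintro c T ⟨hT1, hT2, hT3⟩
    refine ⟨fun x y => ?_, fun a x => ?_, fun g hg f h => ?_⟩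
    · simp only [Pi.smul_apply, hT1 x y, smul_add]
    · simp only [Pi.smul_apply, hT2 a x, smul_comm c a]
    · simp only [Pi.smul_apply, Submodule.coe_smul, hT3 g hg f h, _root_.map_smul]

/-- The additive character `ψ` of `E`, `ψ(x) = ψ'((x + σ(x))/2)`. -/
def psiE (S : USetting E) (x : E) : ℂ := S.psi' ((x + S.sig x) / 2)

/-- `Ψ_Y(g) = ψ(Tr(Y (g − 1)))`. -/
def PsiC (S : USetting E) (Y g : Mat E) : ℂ := psiE S ((Y * (g - 1)).trace)

/-- The Lie algebra `𝔤 = 𝔲(1,1)(F)`. -/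
def gfrak (S : USetting E) : Set (Mat E) :=
  {Y | (Y.map ⇑S.sig)ᵀ * w0 E + w0 E * Y = 0}

/-- The lattice `𝔨_s` of the Lie algebra, where `c = ⌈s⌉`. -/
def kfrakC (S : USetting E) (c : ℤ) : Set (Mat E) :=
  {Y | Y ∈ gfrak S ∧ (c : WithTop ℤ) ≤ S.nu (Y 0 0) ∧ (c : WithTop ℤ) ≤ S.nu (Y 1 1) ∧
    (∃ t, S.sig t = t ∧ (c : WithTop ℤ) ≤ S.nu t ∧ Y 0 1 = S.sqeps * t) ∧
    (∃ t, S.sig t = t ∧ (c : WithTop ℤ) ≤ S.nu t ∧ Y 1 0 = S.sqeps * t)}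

/-- The group `J_d`. -/
def Jgrp (S : USetting E) (d : ℕ) : Set (Mat E) :=
  {g | g ∈ Kset S ∧ ((((d + 1) / 2 : ℕ) : WithTop ℤ) ≤ S.nu (g 0 0 - 1)) ∧
    ((((d + 1) / 2 : ℕ) : WithTop ℤ) ≤ S.nu (g 0 1)) ∧
    ((((d + 1) / 2 : ℕ) : WithTop ℤ) ≤ S.nu (g 1 1 - 1)) ∧
    (((d / 2 + 1 : ℕ) : WithTop ℤ) ≤ S.nu (g 1 0))}

/-- The centralizer `T(X)` in `K` of `X = [[z√ε, u√ε],[v√ε, z√ε]]`. -/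
def TXset (S : USetting E) (u v : E) : Set (Mat E) :=
  {m | m ∈ Kset S ∧ m 1 1 = m 0 0 ∧ m 1 0 = m 0 1 * (u⁻¹ * v)}

/-- The center `Z` of `G`, identified with scalar matrices with entries in `E^1`. -/
def Zset (S : USetting E) : Set (Mat E) := {m | ∃ z ∈ E1set S, m = z • (1 : Mat E)}

/-- `𝒰 = U ∩ K`. -/
def Uset (S : USetting E) : Set (Mat E) :=
  {m | ∃ b, S.sig b = b ∧ 0 ≤ S.nu b ∧ m = !![1, b * S.sqeps; 0, 1]}

/-- The set of products `T(X)·J_d`. -/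
def TXJ (S : USetting E) (u v : E) (d : ℕ) : Set (Mat E) :=
  {x | ∃ t ∈ TXset S u v, ∃ j ∈ Jgrp S d, x = t * j}

/-- The set of products `Z·𝒰·J_d`. -/
def ZUJ (S : USetting E) (d : ℕ) : Set (Mat E) :=
  {x | ∃ z ∈ Zset S, ∃ m ∈ Uset S, ∃ j ∈ Jgrp S d, x = z * m * j}

/-- `X = [[z√ε, u√ε],[v√ε, z√ε]]`. -/
def Xzuv (S : USetting E) (z u v : E) : Mat E :=
  !![z * S.sqeps, u * S.sqeps; v * S.sqeps, z * S.sqeps]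

/-- The nilpotent element `X_δ = [[0, δ√ε],[0,0]]`. -/
def Xdelta (S : USetting E) (δ : E) : Mat E := !![0, δ * S.sqeps; 0, 0]

/-- `W` is a `K`-invariant complement of `V_χ^{K_d}` inside `V_χ^{K_{d+1}}`. -/
def Wcompl (S : USetting E) (χ : E → ℂ) (d : ℕ) (W : Submodule ℂ (Mat E → ℂ)) : Prop :=
  W ≤ Vsp S χ ((d : ℤ) + 1) ∧ KInvariant S W ∧
    Vsp S χ (d : ℤ) ⊓ W = ⊥ ∧ Vsp S χ (d : ℤ) ⊔ W = Vsp S χ ((d : ℤ) + 1)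

namespace USetting

/-- `x` lies in `p_E^n`. -/
def Pge (S : USetting E) (n : ℤ) (x : E) : Prop := (n : WithTop ℤ) ≤ S.nu x

variable (S : USetting E)

theorem nu_eq_int {x : E} (hx : x ≠ 0) : ∃ j : ℤ, S.nu x = j := by
  have h : S.nu x ≠ ⊤ := fun h => hx ((S.nu_eq_top x).1 h)
  exact ⟨(S.nu x).untop h, (WithTop.coe_untop _ h).symm⟩

theorem nu_one : S.nu 1 = 0 := by
  obtain ⟨j, hj⟩ := S.nu_eq_int (one_ne_zero (α := E))
  have h := S.nu_mul 1 1
  rw [mul_one, hj] at h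
  rw [hj]
  norm_cast at h ⊢
  omega

theorem nu_neg (x : E) : S.nu (-x) = S.nu x := by
  have h1 : S.nu (-1) = 0 := by
    obtain ⟨j, hj⟩ := S.nu_eq_int (neg_ne_zero.2 (one_ne_zero (α := E)))
    have h := S.nu_mul (-1) (-1)
    rw [neg_mul_neg, mul_one, hj, S.nu_one] at h
    rw [hj]
    norm_cast at h ⊢
    omega
  rw [← neg_one_mul, S.nu_mul, h1, zero_add]

theorem ne_zero_of_nu {x : E} {j : ℤ} (h : S.nu x = j) : x ≠ 0 := by
  rintro rfl
  rw [(S.nu_eq_top 0).2 rfl] at h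
  exact WithTop.top_ne_coe h

theorem unit_ne_zero {x : E} (h : S.nu x = 0) : x ≠ 0 := S.ne_zero_of_nu (j := 0) h

theorem nu_inv {x : E} {j : ℤ} (h : S.nu x = j) : S.nu x⁻¹ = ((-j : ℤ) : WithTop ℤ) := by
  have hx := S.ne_zero_of_nu h
  obtain ⟨i, hi⟩ := S.nu_eq_int (inv_ne_zero hx)
  have h1 := S.nu_mul x x⁻¹
  rw [mul_inv_cancel₀ hx, S.nu_one, h, hi] at h1
  rw [hi]
  norm_cast at h1 ⊢
  omega

theorem unit_inv {x : E} (h : S.nu x = 0) : S.nu x⁻¹ = 0 := by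
  simpa using S.nu_inv (j := 0) h

theorem unit_mul {x y : E} (hx : S.nu x = 0) (hy : S.nu y = 0) : S.nu (x * y) = 0 := by
  rw [S.nu_mul, hx, hy, add_zero]

theorem unit_sig {x : E} (hx : S.nu x = 0) : S.nu (S.sig x) = 0 := by
  rw [S.nu_sig, hx]

theorem nu_pi_pow (n : ℕ) : S.nu (S.pi ^ n) = ((n : ℤ) : WithTop ℤ) := by
  induction n with
  | zero => simpa using S.nu_one
  | succ n ih =>
    rw [pow_succ, S.nu_mul, ih, S.nu_pi]
    norm_cast

theorem pi_ne_zero : S.pi ≠ 0 := S.ne_zero_of_nu (j := 1) S.nu_pi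

theorem sqeps_ne_zero : S.sqeps ≠ 0 := S.unit_ne_zero S.nu_sqeps

theorem nonzero_two (S : USetting E) : (2 : E) ≠ 0 := S.unit_ne_zero S.nu_two

variable {S}

theorem Pge.zero (n : ℤ) : S.Pge n 0 := by
  unfold Pge
  rw [(S.nu_eq_top 0).2 rfl]
  exact le_top

theorem Pge.add {n : ℤ} {x y : E} (hx : S.Pge n x) (hy : S.Pge n y) : S.Pge n (x + y) :=
  (le_min hx hy).trans (S.nu_add x y)

theorem Pge.neg {n : ℤ} {x : E} (hx : S.Pge n x) : S.Pge n (-x) := by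
  unfold Pge
  rwa [S.nu_neg]

theorem Pge.sub {n : ℤ} {x y : E} (hx : S.Pge n x) (hy : S.Pge n y) : S.Pge n (x - y) := by
  rw [sub_eq_add_neg]
  exact hx.add hy.neg

theorem Pge.mul {m n : ℤ} {x y : E} (hx : S.Pge m x) (hy : S.Pge n y) :
    S.Pge (m + n) (x * y) := by
  unfold Pge at *
  rw [S.nu_mul, WithTop.coe_add]
  exact add_le_add hx hy

theorem Pge.mono {m n : ℤ} {x : E} (hx : S.Pge n x) (h : m ≤ n) : S.Pge m x :=
  (WithTop.coe_le_coe.2 h).trans hx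

theorem Pge.sig {n : ℤ} {x : E} (hx : S.Pge n x) : S.Pge n (S.sig x) := by
  unfold Pge
  rwa [S.nu_sig]

theorem Pge.mul_int {n : ℤ} {x y : E} (hx : S.Pge n x) (hy : S.Pge 0 y) : S.Pge n (x * y) := by
  simpa using hx.mul hy

theorem Pge.int_mul {n : ℤ} {x y : E} (hx : S.Pge 0 x) (hy : S.Pge n y) : S.Pge n (x * y) := by
  simpa using hx.mul hy

theorem Pge.of_nu {n : ℤ} {x : E} (hx : S.nu x = n) : S.Pge n x := hx.symm.le

theorem Pge.of_unit {x : E} (hx : S.nu x = 0) : S.Pge 0 x := Pge.of_nu (n := 0) hx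

theorem Pge.one : S.Pge 0 1 := Pge.of_unit S.nu_one

theorem Pge.le {m n : ℤ} {x : E} (hx : S.Pge n x) (h : S.nu x = m) : n ≤ m := by
  unfold Pge at hx
  rw [h] at hx
  exact_mod_cast hx

theorem Pge.div_nu {m n : ℤ} {x y : E} (hx : S.Pge n x) (hy : S.nu y = m) :
    S.Pge (n - m) (x / y) := by
  rw [div_eq_mul_inv, sub_eq_add_neg]
  exact hx.mul (Pge.of_nu (S.nu_inv hy))

theorem Pge.div_unit {n : ℤ} {x y : E} (hx : S.Pge n x) (hy : S.nu y = 0) :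
    S.Pge n (x / y) := by
  simpa using hx.div_nu (m := 0) hy

theorem Pge.unit_or {x : E} (hx : S.Pge 0 x) : S.nu x = 0 ∨ S.Pge 1 x := by
  by_cases h0 : x = 0
  · exact Or.inr (h0 ▸ Pge.zero 1)
  obtain ⟨j, hj⟩ := S.nu_eq_int h0
  have := hx.le hj
  rcases this.eq_or_lt with h | h
  · exact Or.inl (by rw [hj, ← h]; rfl)
  · exact Or.inr ((Pge.of_nu hj).mono h)

theorem not_Pge_of_nu {m n : ℤ} {x : E} (hx : S.nu x = m) (h : m < n) : ¬ S.Pge n x :=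
  fun h' => absurd (h'.le hx) (not_le.2 h)

theorem Pge.not_unit {x : E} (h : S.Pge 1 x) (hx : S.nu x = 0) : False :=
  not_Pge_of_nu (m := 0) hx one_pos h

theorem nu_of_congr {m n : ℤ} {x y : E} (hx : S.nu x = m) (h : S.Pge n (y - x)) (hmn : m < n) :
    S.nu y = m := by
  have hy : S.Pge m y := by
    have := (h.mono hmn.le).add (Pge.of_nu hx)
    rwa [sub_add_cancel] at this
  have hy' : ¬ S.Pge (m + 1) y := fun h' => by
    have := h'.sub (h.mono (Int.add_one_le_iff.2 hmn))
    rw [sub_sub_cancel] at this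
    exact not_Pge_of_nu hx (Int.lt_succ m) this
  by_cases h0 : y = 0
  · exact absurd (h0 ▸ Pge.zero _) hy'
  obtain ⟨j, hj⟩ := S.nu_eq_int h0
  have h1 := hy.le hj
  by_cases h2 : m + 1 ≤ j
  · exact absurd ((Pge.of_nu hj).mono h2) hy'
  · rw [hj, show j = m by omega]

theorem unit_of_congr {x y : E} (hx : S.nu x = 0) (h : S.Pge 1 (y - x)) : S.nu y = 0 :=
  nu_of_congr (m := 0) hx h one_pos

theorem unit_one_add {y : E} (h : S.Pge 1 y) : S.nu (1 + y) = 0 :=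
  unit_of_congr S.nu_one (by simpa using h)

variable (S)

theorem exists_residues (n : ℕ) : ∃ R : Finset E, R.card = S.q ^ n ∧
    (∀ x ∈ R, S.sig x = x ∧ S.Pge 0 x) ∧
    ∀ y : E, S.sig y = y → S.Pge 0 y → ∃! x, x ∈ R ∧ S.Pge n (y - x) := by
  classical
  induction n with
  | zero =>
    refine ⟨{0}, by simp, ?_, ?_⟩
    · intro x hx
      rw [Finset.mem_singleton] at hx
      subst hx
      exact ⟨map_zero _, Pge.zero 0⟩
    · intro y _ hy0
      exact ⟨0, ⟨by simp, by simpa using hy0⟩, fun z hz => by simpa using hz.1⟩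
  | succ n ih =>
    obtain ⟨R, hRc, hR, hRu⟩ := ih
    obtain ⟨R₁, hc₁, h₁, hu₁⟩ := S.res_card
    have hpi := S.nu_pi_pow n
    have hpi0 : S.pi ^ n ≠ 0 := pow_ne_zero _ S.pi_ne_zero
    have hP1 : ∀ x, (1 : WithTop ℤ) ≤ S.nu x ↔ S.Pge 1 x := fun x => Iff.rfl
    have hP0 : ∀ x, (0 : WithTop ℤ) ≤ S.nu x ↔ S.Pge 0 x := fun x => Iff.rfl
    simp only [hP1, hP0] at h₁ hu₁
    have key : ∀ x ∈ R, ∀ t ∈ R₁, ∀ x' ∈ R, ∀ t' ∈ R₁,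
        S.Pge (n + 1) ((x + S.pi ^ n * t) - (x' + S.pi ^ n * t')) → x = x' ∧ t = t' := by
      intro x hx t ht x' hx' t' ht' h
      have hxx : x = x' := by
        refine (hRu x (hR x hx).1 (hR x hx).2).unique ⟨hx, by simpa using Pge.zero _⟩ ⟨hx', ?_⟩
        have := (h.mono (by omega : (n : ℤ) ≤ n + 1)).sub
          ((Pge.of_nu hpi).mul_int ((h₁ t ht).2.sub (h₁ t' ht').2))
        convert this using 1
        ring
      subst hxx
      refine ⟨rfl, (hu₁ t (h₁ t ht).1 (h₁ t ht).2).unique ⟨ht, by simpa using Pge.zero _⟩ ⟨ht', ?_⟩⟩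
      have := h.div_nu hpi
      convert this using 1
      · ring
      · field_simp
        ring
    refine ⟨(R ×ˢ R₁).image (fun p => p.1 + S.pi ^ n * p.2), ?_, ?_, ?_⟩
    · rw [Finset.card_image_of_injOn, Finset.card_product, hRc, hc₁, pow_succ]
      rintro ⟨x, t⟩ hx ⟨x', t'⟩ hx' h
      simp only [Finset.coe_product, Set.mem_prod, Finset.mem_coe] at hx hx'
      have := key x hx.1 t hx.2 x' hx'.1 t' hx'.2 (by
        simp only at h
        rw [h, sub_self]
        exact Pge.zero _)
      rw [this.1, this.2]
    · intro z hz
      simp only [Finset.mem_image, Finset.mem_product, Prod.exists] at hz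
      obtain ⟨x, t, ⟨hx, ht⟩, rfl⟩ := hz
      refine ⟨by rw [map_add, map_mul, map_pow, S.sig_pi, (hR x hx).1, (h₁ t ht).1], ?_⟩
      exact (hR x hx).2.add (((Pge.of_nu hpi).mono (by omega)).mul_int (h₁ t ht).2)
    · intro y hy hy0
      obtain ⟨x, ⟨hx, hxy⟩, -⟩ := hRu y hy hy0
      obtain ⟨t, ⟨ht, hty⟩, -⟩ := hu₁ ((y - x) / S.pi ^ n)
        (by rw [map_div₀, map_sub, map_pow, S.sig_pi, hy, (hR x hx).1])
        (by simpa using hxy.div_nu hpi)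
      have hy' : S.Pge (n + 1) (y - (x + S.pi ^ n * t)) := by
        have := (Pge.of_nu hpi).mul hty
        convert this using 1
        field_simp
        ring
      refine ⟨x + S.pi ^ n * t, ⟨Finset.mem_image.2 ⟨(x, t), Finset.mem_product.2 ⟨hx, ht⟩, rfl⟩,
        by exact_mod_cast hy'⟩, ?_⟩
      rintro z ⟨hz, hzy⟩
      simp only [Finset.mem_image, Finset.mem_product, Prod.exists] at hz
      obtain ⟨x', t', ⟨hx', ht'⟩, rfl⟩ := hz
      have := key x' hx' t' ht' x hx t ht (by
        have h2 := hy'.sub (by exact_mod_cast hzy : S.Pge (n + 1) _)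
        convert h2 using 1
        ring)
      rw [this.1, this.2]

theorem two_le_q : 2 ≤ S.q := by
  obtain ⟨R, hc, -, hu⟩ := S.res_card
  obtain ⟨x, ⟨hx, hx'⟩, -⟩ := hu 0 (map_zero _) (Pge.zero (S := S) 0)
  obtain ⟨y, ⟨hy, hy'⟩, -⟩ := hu 1 (map_one _) (Pge.one (S := S))
  rw [← hc]
  refine Finset.one_lt_card.2 ⟨x, hx, y, hy, ?_⟩
  rintro rfl
  have : S.Pge 1 ((1 - x) - (0 - x)) := Pge.sub hy' hx'
  rw [sub_sub_sub_cancel_right, sub_zero] at this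
  exact this.not_unit S.nu_one

/-- The ring of integers of `F`. -/
def OF : Subring E where
  carrier := {x | S.sig x = x ∧ S.Pge 0 x}
  mul_mem' := fun {x y} hx hy => ⟨by rw [map_mul, hx.1, hy.1], hx.2.mul_int hy.2⟩
  one_mem' := ⟨map_one _, Pge.one⟩
  add_mem' := fun {x y} hx hy => ⟨by rw [map_add, hx.1, hy.1], hx.2.add hy.2⟩
  zero_mem' := ⟨map_zero _, Pge.zero 0⟩
  neg_mem' := fun {x} hx => ⟨by rw [map_neg, hx.1], hx.2.neg⟩

/-- The maximal ideal of the ring of integers of `F`. -/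
def pF : Ideal S.OF where
  carrier := {x | S.Pge 1 (x : E)}
  add_mem' := fun hx hy => Pge.add hx hy
  zero_mem' := Pge.zero 1
  smul_mem' := fun c _ hx => Pge.int_mul c.2.2 hx

theorem mem_pF {x : S.OF} : x ∈ S.pF ↔ S.Pge 1 (x : E) := Iff.rfl

theorem pF_isMaximal : S.pF.IsMaximal := by
  rw [Ideal.isMaximal_iff]
  refine ⟨fun h => Pge.not_unit (S.mem_pF.1 h) S.nu_one, fun J x _ hx hxJ => ?_⟩
  have hu : S.nu (x : E) = 0 := (x.2.2.unit_or).resolve_right hx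
  have hinv : (x : E)⁻¹ ∈ S.OF := ⟨by rw [map_inv₀, x.2.1], Pge.of_unit (S.unit_inv hu)⟩
  have := J.mul_mem_left ⟨(x : E)⁻¹, hinv⟩ hxJ
  convert this
  refine Subtype.ext ?_
  exact (inv_mul_cancel₀ (S.unit_ne_zero hu)).symm

theorem finite_residueField : Finite (S.OF ⧸ S.pF) := by
  obtain ⟨R, -, hR, hu⟩ := S.res_card
  refine Finite.of_surjective (fun x : R => Ideal.Quotient.mk S.pF ⟨x, hR x x.2⟩) fun y => ?_
  obtain ⟨y, rfl⟩ := Ideal.Quotient.mk_surjective y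
  obtain ⟨x, ⟨hx, hxy⟩, -⟩ := hu y y.2.1 y.2.2
  refine ⟨⟨x, hx⟩, (Ideal.Quotient.eq.2 ?_).symm⟩
  exact hxy

theorem exists_norm_residue {u : E} (hu : S.sig u = u) (hu0 : S.nu u = 0) :
    ∃ a, S.nu a = 0 ∧ S.Pge 1 (a * S.sig a - u) := by
  have := S.pF_isMaximal
  let : Field (S.OF ⧸ S.pF) := Ideal.Quotient.field _
  have := S.finite_residueField
  let := Fintype.ofFinite (S.OF ⧸ S.pF)
  have h2 : ringChar (S.OF ⧸ S.pF) ≠ 2 := by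
    intro h
    have h0 : Ideal.Quotient.mk S.pF 2 = 0 := by
      have := CharP.cast_eq_zero (S.OF ⧸ S.pF) (ringChar (S.OF ⧸ S.pF))
      rw [h] at this
      exact_mod_cast this
    exact Pge.not_unit (S.mem_pF.1 (Ideal.Quotient.eq_zero_iff_mem.1 h0)) S.nu_two
  have heps : S.sqeps * S.sqeps ∈ S.OF := ⟨by rw [map_mul, S.sig_sqeps]; ring,
    Pge.of_unit (S.unit_mul S.nu_sqeps S.nu_sqeps)⟩
  let e : S.OF := ⟨_, heps⟩
  let v : S.OF := ⟨u, hu, Pge.of_unit hu0⟩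
  let m := Ideal.Quotient.mk S.pF
  have he : m e ≠ 0 := fun h => Pge.not_unit (S.mem_pF.1 (Ideal.Quotient.eq_zero_iff_mem.1 h))
    (S.unit_mul S.nu_sqeps S.nu_sqeps)
  obtain ⟨x, y, hxy⟩ := FiniteField.exists_root_sum_quadratic
    (f := (Polynomial.X ^ 2 : Polynomial (S.OF ⧸ S.pF)))
    (g := Polynomial.C (-m e) * Polynomial.X ^ 2 + Polynomial.C 0 * Polynomial.X
      + Polynomial.C (-m v)) (Polynomial.degree_X_pow 2)
    (Polynomial.degree_quadratic (neg_ne_zero.2 he)) (FiniteField.odd_card_of_char_ne_two h2)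
  obtain ⟨x, rfl⟩ := Ideal.Quotient.mk_surjective x
  obtain ⟨y, rfl⟩ := Ideal.Quotient.mk_surjective y
  have hxy' : m (x ^ 2 - e * y ^ 2 - v) = 0 := by
    simp only [Polynomial.eval_add, Polynomial.eval_mul, Polynomial.eval_pow, Polynomial.eval_C,
      Polynomial.eval_X] at hxy
    simp only [map_sub, map_mul, map_pow]
    linear_combination hxy
  have h := S.mem_pF.1 (Ideal.Quotient.eq_zero_iff_mem.1 hxy')
  have h' : S.Pge 1 ((x + y * S.sqeps) * S.sig (x + y * S.sqeps) - u) := by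
    convert h using 1
    simp only [map_add, map_mul, S.sig_sqeps, x.2.1, y.2.1]
    have : ((x ^ 2 - e * y ^ 2 - v : S.OF) : E) = x ^ 2 - S.sqeps * S.sqeps * y ^ 2 - u := rfl
    rw [this]
    ring
  refine ⟨x + y * S.sqeps, ?_, h'⟩
  have h1 := unit_of_congr hu0 h'
  have h0 : S.Pge 0 (x + y * S.sqeps) :=
    x.2.2.add (y.2.2.mul_int (Pge.of_unit S.nu_sqeps))
  exact h0.unit_or.resolve_right fun h => Pge.not_unit (h.mul_int (h.sig.mono zero_le_one)) h1

/-- Every unit of `O_F` is a norm from `O_E^×` up to arbitrarily small error. -/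
theorem exists_norm {u : E} (hu : S.sig u = u) (hu0 : S.nu u = 0) (n : ℕ) :
    ∃ a, S.nu a = 0 ∧ S.Pge n (a * S.sig a - u) := by
  have hmain : ∀ n : ℕ, ∃ a, S.nu a = 0 ∧ S.Pge (n + 1) (a * S.sig a - u) := by
    intro n
    induction n with
    | zero => simpa using S.exists_norm_residue hu hu0
    | succ n ih =>
      obtain ⟨a, ha, h⟩ := ih
      set N := a * S.sig a with hN
      have hN0 : S.nu N = 0 := S.unit_mul ha (S.unit_sig ha)
      have hNs : S.sig N = N := by rw [hN, map_mul, S.sig_invol, mul_comm]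
      have hNne := S.unit_ne_zero hN0
      have h2 := S.nonzero_two
      set y := (u - N) / (2 * N) with hy
      have hyP : S.Pge (n + 1) y := by
        refine Pge.div_unit ?_ (S.unit_mul S.nu_two hN0)
        simpa using h.neg
      have hys : S.sig y = y := by
        rw [hy, map_div₀, map_sub, map_mul S.sig 2 N, hNs, hu, map_ofNat]
      refine ⟨a * (1 + y), S.unit_mul ha (unit_one_add (hyP.mono (by omega))), ?_⟩
      have : a * (1 + y) * S.sig (a * (1 + y)) - u = N * (y * y) := by
        have e1 : a * (1 + y) * S.sig (a * (1 + y)) = N * (1 + y) ^ 2 := by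
          rw [map_mul, map_add, map_one, hys, hN]
          ring
        have e2 : 2 * N * y = u - N := by
          rw [hy]
          field_simp
        rw [e1]
        linear_combination e2
      rw [this]
      refine Pge.int_mul (Pge.of_unit hN0) ((hyP.mul hyP).mono ?_)
      push_cast
      omega
  obtain ⟨a, ha, h⟩ := hmain n
  exact ⟨a, ha, h.mono (by omega)⟩

end USetting

open USetting

section KGroup

variable {S : USetting E}

/-- The inverse of an element of `U(1,1)`. -/
def kinv (S : USetting E) (g : Mat E) : Mat E :=
  !![S.sig (g 1 1), S.sig (g 0 1); S.sig (g 1 0), S.sig (g 0 0)]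

theorem kinv_eq (S : USetting E) (g : Mat E) : kinv S g = w0 E * (g.map ⇑S.sig)ᵀ * w0 E := by
  ext i j
  fin_cases i <;> fin_cases j <;> simp [kinv, w0, Matrix.mul_apply, Matrix.vecMul, dotProduct]

theorem w0_mul_w0 : w0 E * w0 E = 1 := by
  ext i j
  fin_cases i <;> fin_cases j <;> simp [w0]

theorem mem_Gset_iff {g : Mat E} : g ∈ Gset S ↔ kinv S g * g = 1 := by
  have hw := w0_mul_w0 (E := E)
  rw [kinv_eq]
  constructor
  · intro h
    change (g.map ⇑S.sig)ᵀ * w0 E * g = w0 E at h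
    rw [Matrix.mul_assoc, Matrix.mul_assoc, ← Matrix.mul_assoc _ (w0 E) g, h, hw]
  · intro h
    change (g.map ⇑S.sig)ᵀ * w0 E * g = w0 E
    have := congrArg (w0 E * ·) h
    simp only [Matrix.mul_assoc, Matrix.mul_one] at this ⊢
    rwa [← Matrix.mul_assoc (w0 E) (w0 E), hw, Matrix.one_mul] at this

theorem kinv_kinv (g : Mat E) : kinv S (kinv S g) = g := by
  ext i j
  fin_cases i <;> fin_cases j <;> simp [kinv, S.sig_invol]

theorem kinv_mul_rev (g h : Mat E) : kinv S (g * h) = kinv S h * kinv S g := by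
  ext i j
  fin_cases i <;> fin_cases j <;> simp [kinv, Matrix.mul_apply, Fin.sum_univ_two] <;> ring

theorem kinv_one : kinv S (1 : Mat E) = 1 := by
  ext i j
  fin_cases i <;> fin_cases j <;> simp [kinv]

theorem kinv_mul_self {g : Mat E} (hg : g ∈ Kset S) : kinv S g * g = 1 := mem_Gset_iff.1 hg.1

theorem mul_kinv_self {g : Mat E} (hg : g ∈ Kset S) : g * kinv S g = 1 :=
  mul_eq_one_comm.1 (kinv_mul_self hg)

theorem det_unit_of_mem_Gset {g : Mat E} (hg : kinv S g * g = 1)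
    (hi : ∀ i j, S.Pge 0 (g i j)) : S.nu g.det = 0 := by
  have h1 := congrArg Matrix.det hg
  rw [Matrix.det_mul, Matrix.det_one] at h1
  have hd : S.Pge 0 g.det := by
    rw [Matrix.det_fin_two]
    exact ((hi _ _).mul_int (hi _ _)).sub ((hi _ _).mul_int (hi _ _))
  have hd' : S.Pge 0 (kinv S g).det := by
    rw [Matrix.det_fin_two]
    simp only [kinv, Matrix.of_apply, Matrix.cons_val', Matrix.cons_val_zero, Matrix.cons_val_one,
      Matrix.cons_val_fin_one]
    exact ((hi _ _).sig.mul_int (hi _ _).sig).sub ((hi _ _).sig.mul_int (hi _ _).sig)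
  refine hd.unit_or.resolve_right fun h => ?_
  exact Pge.not_unit (hd'.int_mul h) (by rw [h1, S.nu_one])

theorem mem_Kset_iff {g : Mat E} :
    g ∈ Kset S ↔ kinv S g * g = 1 ∧ ∀ i j, S.Pge 0 (g i j) :=
  ⟨fun h => ⟨kinv_mul_self h, h.2.1⟩,
    fun h => ⟨mem_Gset_iff.2 h.1, h.2, det_unit_of_mem_Gset h.1 h.2⟩⟩

theorem one_mem_Kset : (1 : Mat E) ∈ Kset S := by
  refine mem_Kset_iff.2 ⟨by rw [kinv_one, mul_one], fun i j => ?_⟩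
  rw [Matrix.one_apply]
  split_ifs
  exacts [Pge.one, Pge.zero 0]

theorem mul_mem_Kset {g h : Mat E} (hg : g ∈ Kset S) (hh : h ∈ Kset S) : g * h ∈ Kset S := by
  rw [mem_Kset_iff] at *
  refine ⟨?_, fun i j => ?_⟩
  · rw [kinv_mul_rev, Matrix.mul_assoc, ← Matrix.mul_assoc _ g h, hg.1, Matrix.one_mul, hh.1]
  · rw [Matrix.mul_apply, Fin.sum_univ_two]
    exact ((hg.2 _ _).mul_int (hh.2 _ _)).add ((hg.2 _ _).mul_int (hh.2 _ _))

theorem kinv_mem_Kset {g : Mat E} (hg : g ∈ Kset S) : kinv S g ∈ Kset S := by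
  refine mem_Kset_iff.2 ⟨by rw [kinv_kinv, mul_kinv_self hg], fun i j => ?_⟩
  have := (mem_Kset_iff.1 hg).2
  fin_cases i <;> fin_cases j <;> exact (this _ _).sig

theorem mul_mem_Kset_iff {g h : Mat E} (hg : g ∈ Kset S) : g * h ∈ Kset S ↔ h ∈ Kset S := by
  refine ⟨fun hh => ?_, mul_mem_Kset hg⟩
  have := mul_mem_Kset (kinv_mem_Kset hg) hh
  rwa [← Matrix.mul_assoc, kinv_mul_self hg, Matrix.one_mul] at this

theorem mul_mem_Kset_iff' {g h : Mat E} (hg : g ∈ Kset S) : h * g ∈ Kset S ↔ h ∈ Kset S := by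
  refine ⟨fun hh => ?_, fun hh => mul_mem_Kset hh hg⟩
  have := mul_mem_Kset hh (kinv_mem_Kset hg)
  rwa [Matrix.mul_assoc, mul_kinv_self hg, Matrix.mul_one] at this

theorem Kset_int {g : Mat E} (hg : g ∈ Kset S) (i j) : S.Pge 0 (g i j) := hg.2.1 i j

theorem Kset_row_isotropic {g : Mat E} (hg : g ∈ Kset S) :
    g 1 0 * S.sig (g 1 1) + g 1 1 * S.sig (g 1 0) = 0 := by
  have := congrFun (congrFun (mul_kinv_self hg) 1) 0
  simpa [Matrix.mul_apply, Fin.sum_univ_two, kinv] using this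

theorem Kset_diag {g : Mat E} (hg : g ∈ Kset S) :
    g 0 0 * S.sig (g 1 1) + g 0 1 * S.sig (g 1 0) = 1 := by
  have := congrFun (congrFun (mul_kinv_self hg) 0) 0
  simpa [Matrix.mul_apply, Fin.sum_univ_two, kinv] using this

theorem Kset_col_isotropic {g : Mat E} (hg : g ∈ Kset S) :
    S.sig (g 1 0) * g 0 0 + S.sig (g 0 0) * g 1 0 = 0 := by
  have := congrFun (congrFun (kinv_mul_self hg) 1) 0
  simpa [Matrix.mul_apply, Fin.sum_univ_two, kinv] using this

theorem unit_of_nonunit {g : Mat E} (hg : g ∈ Kset S) (h : S.Pge 1 (g 1 0)) :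
    S.nu (g 1 1) = 0 := by
  refine (Kset_int hg 1 1).unit_or.resolve_right fun h' => ?_
  have h1 := ((Kset_int hg 0 0).int_mul h'.sig).add ((Kset_int hg 0 1).int_mul h.sig)
  rw [Kset_diag hg] at h1
  exact h1.not_unit S.nu_one

/-- The ratio of the entries of the bottom row is skew. -/
theorem skew_div {x y : E} (hy : y ≠ 0) (h : x * S.sig y + y * S.sig x = 0) :
    S.sig (x / y) = -(x / y) := by
  have hy' : S.sig y ≠ 0 := (map_ne_zero S.sig).2 hy
  rw [map_div₀]
  field_simp
  linear_combination h

/-- The group `Γ₀(p^n)`: elements of `K` that are upper triangular modulo `p_E^n`. -/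
def Gam (S : USetting E) (n : ℤ) : Set (Mat E) := {g | g ∈ Kset S ∧ S.Pge n (g 1 0)}

theorem one_mem_Gam (n : ℤ) : (1 : Mat E) ∈ Gam S n :=
  ⟨one_mem_Kset, by simpa using Pge.zero n⟩

theorem mul_mem_Gam {n : ℤ} {g h : Mat E} (hg : g ∈ Gam S n) (hh : h ∈ Gam S n) :
    g * h ∈ Gam S n := by
  refine ⟨mul_mem_Kset hg.1 hh.1, ?_⟩
  rw [Matrix.mul_apply, Fin.sum_univ_two]
  exact (hg.2.mul_int (Kset_int hh.1 _ _)).add ((Kset_int hg.1 _ _).int_mul hh.2)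

theorem kinv_mem_Gam {n : ℤ} {g : Mat E} (hg : g ∈ Gam S n) : kinv S g ∈ Gam S n :=
  ⟨kinv_mem_Kset hg.1, hg.2.sig⟩

theorem Bcal_subset_Gam (n : ℤ) : Bcal S ⊆ Gam S n := fun g hg => ⟨hg.1, by
  rw [hg.2]
  exact Pge.zero n⟩

theorem mul_mem_Gam_iff {n : ℤ} {g h : Mat E} (hg : g ∈ Gam S n) :
    g * h ∈ Gam S n ↔ h ∈ Gam S n := by
  refine ⟨fun hh => ?_, mul_mem_Gam hg⟩
  have := mul_mem_Gam (kinv_mem_Gam hg) hh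
  rwa [← Matrix.mul_assoc, kinv_mul_self hg.1, Matrix.one_mul] at this

theorem mul_mem_Gam_iff' {n : ℤ} {g h : Mat E} (hg : g ∈ Gam S n) :
    h * g ∈ Gam S n ↔ h ∈ Gam S n := by
  refine ⟨fun hh => ?_, fun hh => mul_mem_Gam hh hg⟩
  have := mul_mem_Gam hh (kinv_mem_Gam hg)
  rwa [Matrix.mul_assoc, mul_kinv_self hg.1, Matrix.mul_one] at this

theorem mem_Kfil_iff {n : ℤ} {g : Mat E} :
    g ∈ Kfil S n ↔ g ∈ Kset S ∧ ∀ i j, S.Pge n ((g - 1) i j) := Iff.rfl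

theorem Pge_entry_mul {m n : ℤ} {g h : Mat E} (hg : ∀ i j, S.Pge m (g i j))
    (hh : ∀ i j, S.Pge n (h i j)) (i j) : S.Pge (m + n) ((g * h) i j) := by
  rw [Matrix.mul_apply, Fin.sum_univ_two]
  exact ((hg _ _).mul (hh _ _)).add ((hg _ _).mul (hh _ _))

theorem kinv_mul_mem_Kfil {n : ℤ} {g h : Mat E} (hg : g ∈ Kset S) (hh : h ∈ Kset S)
    (hgh : ∀ i j, S.Pge n (h i j - g i j)) : kinv S g * h ∈ Kfil S n := by
  refine ⟨mul_mem_Kset (kinv_mem_Kset hg) hh, fun i j => ?_⟩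
  have : kinv S g * h - 1 = kinv S g * (h - g) := by
    rw [Matrix.mul_sub, kinv_mul_self hg]
  rw [this]
  change S.Pge n _
  simpa using Pge_entry_mul (Kset_int (kinv_mem_Kset hg)) (h := h - g) hgh i j

theorem conj_mem_Kfil {n : ℤ} {k g : Mat E} (hk : k ∈ Kset S) (hg : g ∈ Kfil S n) :
    k * g * kinv S k ∈ Kfil S n := by
  refine ⟨mul_mem_Kset (mul_mem_Kset hk hg.1) (kinv_mem_Kset hk), fun i j => ?_⟩
  have : k * g * kinv S k - 1 = k * (g - 1) * kinv S k := by
    rw [Matrix.mul_sub, Matrix.sub_mul, Matrix.mul_one, mul_kinv_self hk]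
  rw [this]
  change S.Pge n _
  simpa using Pge_entry_mul (fun i j => Pge_entry_mul (Kset_int hk) hg.2 i j)
    (Kset_int (kinv_mem_Kset hk)) i j

theorem Kfil_subset_Gam {n : ℤ} : Kfil S n ⊆ Gam S n :=
  fun g hg => ⟨hg.1, by simpa using (mem_Kfil_iff.1 hg).2 1 0⟩

theorem Kfil_mono {m n : ℤ} (h : m ≤ n) : Kfil S n ⊆ Kfil S m :=
  fun _ hg => ⟨hg.1, fun i j => Pge.mono (hg.2 i j) h⟩

/-- Lower triangular unipotent matrices. -/
def lowU (y : E) : Mat E := !![1, 0; y, 1]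

/-- Upper triangular unipotent matrices. -/
def upU (x : E) : Mat E := !![1, x; 0, 1]

/-- The diagonal torus of `U(1,1)`, parametrized by its lower entry. -/
def dg (S : USetting E) (e : E) : Mat E := !![(S.sig e)⁻¹, 0; 0, e]

theorem lowU_mem {y : E} (hy : S.sig y = -y) (h : S.Pge 0 y) : lowU y ∈ Kset S := by
  refine mem_Kset_iff.2 ⟨?_, fun i j => ?_⟩
  · ext i j
    fin_cases i <;> fin_cases j <;> simp [kinv, lowU, hy]
  · fin_cases i <;> fin_cases j <;> simp [lowU, Pge.one, Pge.zero, h]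

theorem upU_mem {x : E} (hx : S.sig x = -x) (h : S.Pge 0 x) : upU x ∈ Kset S := by
  refine mem_Kset_iff.2 ⟨?_, fun i j => ?_⟩
  · ext i j
    fin_cases i <;> fin_cases j <;> simp [kinv, upU, hx]
  · fin_cases i <;> fin_cases j <;> simp [upU, Pge.one, Pge.zero, h]

theorem dg_mem {e : E} (he : S.nu e = 0) : dg S e ∈ Kset S := by
  have h0 := S.unit_ne_zero he
  have h1 : S.sig e ≠ 0 := (map_ne_zero S.sig).2 h0
  refine mem_Kset_iff.2 ⟨?_, fun i j => ?_⟩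
  · ext i j
    fin_cases i <;> fin_cases j <;> simp [kinv, dg, S.sig_invol, h0, h1]
  · fin_cases i <;> fin_cases j <;>
      simp [dg, Pge.zero, Pge.of_unit he, Pge.of_unit (S.unit_inv (S.unit_sig he))]

theorem w0_mem : w0 E ∈ Kset S := by
  refine mem_Kset_iff.2 ⟨?_, fun i j => ?_⟩
  · ext i j
    fin_cases i <;> fin_cases j <;> simp [kinv, w0]
  · fin_cases i <;> fin_cases j <;> simp [w0, Pge.zero, Pge.one]

theorem lowU_mem_Kfil {n : ℤ} (hn : 0 ≤ n) {y : E} (hy : S.sig y = -y) (h : S.Pge n y) :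
    lowU y ∈ Kfil S n := by
  refine ⟨lowU_mem hy (h.mono hn), fun i j => ?_⟩
  change S.Pge n _
  fin_cases i <;> fin_cases j <;> simp [lowU, Pge.zero, h]

theorem lowU_mul_lowU (x y : E) : lowU x * lowU y = lowU (x + y) := by
  ext i j
  fin_cases i <;> fin_cases j <;> simp [lowU]

theorem lowU_zero : lowU (0 : E) = 1 := by
  ext i j
  fin_cases i <;> fin_cases j <;> simp [lowU]

/-- An element of `K` with unit lower right entry factors through the upper triangular group. -/
theorem exists_Bcal_lowU {g : Mat E} (hg : g ∈ Kset S) (hd : S.nu (g 1 1) = 0) :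
    ∃ b ∈ Bcal S, b 1 1 = g 1 1 ∧ g = b * lowU (g 1 0 / g 1 1) ∧
      S.sig (g 1 0 / g 1 1) = -(g 1 0 / g 1 1) := by
  have h0 := S.unit_ne_zero hd
  have hs := skew_div h0 (Kset_row_isotropic hg)
  have hP : S.Pge 0 (g 1 0 / g 1 1) := (Kset_int hg 1 0).div_unit hd
  refine ⟨g * lowU (-(g 1 0 / g 1 1)), ⟨mul_mem_Kset hg (lowU_mem ?_ hP.neg), ?_⟩, ?_, ?_, hs⟩
  · rw [map_neg, hs]
  · simp [Matrix.mul_apply, Fin.sum_univ_two, lowU]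
    field_simp
    ring
  · simp [Matrix.mul_apply, Fin.sum_univ_two, lowU]
  · rw [Matrix.mul_assoc, lowU_mul_lowU, neg_add_cancel, lowU_zero, Matrix.mul_one]

/-- The Bruhat decomposition of the big cell. -/
theorem big_cell {g : Mat E} (hg : g ∈ Kset S) (hc : S.nu (g 1 0) = 0) :
    ∃ x y, S.sig x = -x ∧ S.sig y = -y ∧ S.Pge 0 x ∧ S.Pge 0 y ∧
      g = upU x * dg S (g 1 0) * w0 E * upU y := by
  have h0 := S.unit_ne_zero hc
  have h0' : S.sig (g 1 0) ≠ 0 := (map_ne_zero S.sig).2 h0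
  refine ⟨g 0 0 / g 1 0, g 1 1 / g 1 0, ?_, ?_, (Kset_int hg 0 0).div_unit hc,
    (Kset_int hg 1 1).div_unit hc, ?_⟩
  · exact skew_div h0 (by linear_combination Kset_col_isotropic hg)
  · exact skew_div h0 (by linear_combination Kset_row_isotropic hg)
  · have h1 := Kset_diag hg
    have h2 := Kset_row_isotropic hg
    have h3 : g 0 1 = (S.sig (g 1 0))⁻¹ + g 0 0 / g 1 0 * g 1 0 * (g 1 1 / g 1 0) := by
      field_simp
      linear_combination (g 1 0) * h1 - g 0 0 * h2
    ext i j
    fin_cases i <;> fin_cases j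
    · simp [Matrix.mul_apply, Fin.sum_univ_two, upU, dg, w0, h0]
    · simp only [Fin.zero_eta, Fin.mk_one]
      rw [h3]
      simp [Matrix.mul_apply, Fin.sum_univ_two, upU, dg, w0, h0]
      ring
    · simp [Matrix.mul_apply, Fin.sum_univ_two, upU, dg, w0]
    · simp [Matrix.mul_apply, Fin.sum_univ_two, upU, dg, w0]
      field_simp

theorem Bcal_diag {b : Mat E} (hb : b ∈ Bcal S) : b 0 0 = (S.sig (b 1 1))⁻¹ := by
  have := Kset_diag hb.1
  rw [hb.2, map_zero, mul_zero, add_zero] at this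
  exact eq_inv_of_mul_eq_one_left this

theorem Bcal_unit {b : Mat E} (hb : b ∈ Bcal S) : S.nu (b 1 1) = 0 :=
  unit_of_nonunit hb.1 (by rw [hb.2]; exact Pge.zero 1)

end KGroup

section Functions

variable {S : USetting E} {χ : E → ℂ} {r : ℕ}

theorem IsChar.map_one (hχ : IsChar χ) : χ 1 = 1 := by
  have h := hχ.1 1 1 one_ne_zero one_ne_zero
  rw [mul_one] at h
  exact (mul_eq_left₀ (hχ.2 1 one_ne_zero)).1 h.symm

theorem IsChar.map_inv (hχ : IsChar χ) {x : E} (hx : x ≠ 0) : χ x⁻¹ = (χ x)⁻¹ := by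
  have h := hχ.1 x x⁻¹ hx (inv_ne_zero hx)
  rw [mul_inv_cancel₀ hx, hχ.map_one] at h
  exact eq_inv_of_mul_eq_one_right h.symm

theorem HasDepth.congr (hχ : IsChar χ) (hr : HasDepth S χ r) {n : ℤ} (hn : (r : ℤ) + 1 ≤ n)
    {x y : E} (hx : S.nu x = 0) (h : S.Pge n (y - x)) : χ y = χ x := by
  have hx0 := S.unit_ne_zero hx
  have hy : S.nu y = 0 := unit_of_congr hx (h.mono (by omega))
  have h1 : χ (y / x) = 1 := by
    refine hr.1 _ ?_
    have : y / x - 1 = (y - x) / x := by field_simp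
    change S.Pge _ _
    rw [this]
    exact (h.mono hn).div_unit hx
  have h2 := hχ.1 x (y / x) hx0 (div_ne_zero (S.unit_ne_zero hy) hx0)
  rw [mul_div_cancel₀ _ hx0, h1, mul_one] at h2
  exact h2

/-- The character `m ↦ χ(σ(m₁₁))⁻¹` of `Γ₀(p^n)`. -/
def theta (S : USetting E) (χ : E → ℂ) (m : Mat E) : ℂ := (χ (S.sig (m 1 1)))⁻¹

theorem theta_ne_zero (hχ : IsChar χ) {m : Mat E} (hm : m ∈ Gam S 1) : theta S χ m ≠ 0 :=
  inv_ne_zero (hχ.2 _ (S.unit_ne_zero (S.unit_sig (unit_of_nonunit hm.1 hm.2))))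

theorem theta_mul (hχ : IsChar χ) (hr : HasDepth S χ r) {n : ℤ} (hn : (r : ℤ) + 1 ≤ n)
    {m m' : Mat E} (hm : m ∈ Gam S n) (hm' : m' ∈ Gam S n) :
    theta S χ (m * m') = theta S χ m * theta S χ m' := by
  have h1 := unit_of_nonunit hm.1 (hm.2.mono (by omega))
  have h2 := unit_of_nonunit hm'.1 (hm'.2.mono (by omega))
  have h : χ (S.sig ((m * m') 1 1)) = χ (S.sig (m 1 1) * S.sig (m' 1 1)) := by
    refine hr.congr hχ hn (S.unit_mul (S.unit_sig h1) (S.unit_sig h2)) ?_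
    rw [← map_mul, ← map_sub]
    refine Pge.sig ?_
    rw [Matrix.mul_apply, Fin.sum_univ_two, add_sub_cancel_right]
    exact hm.2.mul_int (Kset_int hm'.1 _ _)
  unfold theta
  rw [h, hχ.1 _ _ (S.unit_ne_zero (S.unit_sig h1)) (S.unit_ne_zero (S.unit_sig h2)), mul_inv]

theorem theta_one (hχ : IsChar χ) : theta S χ 1 = 1 := by
  simp [theta, hχ.map_one]

theorem theta_kinv (hχ : IsChar χ) (hr : HasDepth S χ r) {n : ℤ} (hn : (r : ℤ) + 1 ≤ n)
    {m : Mat E} (hm : m ∈ Gam S n) : theta S χ (kinv S m) * theta S χ m = 1 := by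
  rw [← theta_mul hχ hr hn (kinv_mem_Gam hm) hm, kinv_mul_self hm.1, theta_one hχ]

theorem theta_Kfil (hχ : IsChar χ) (hr : HasDepth S χ r) {n : ℤ} (hn : (r : ℤ) + 1 ≤ n)
    {m : Mat E} (hm : m ∈ Kfil S n) : theta S χ m = 1 := by
  have : χ (S.sig (m 1 1)) = χ 1 := by
    refine hr.congr hχ hn S.nu_one ?_
    rw [← _root_.map_one S.sig, ← map_sub]
    refine Pge.sig ?_
    simpa using (mem_Kfil_iff.1 hm).2 1 1
  rw [theta, this, hχ.map_one, inv_one]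

theorem theta_Bcal (hχ : IsChar χ) {b : Mat E} (hb : b ∈ Bcal S) :
    χ (b 0 0) = theta S χ b := by
  rw [Bcal_diag hb, hχ.map_inv (S.unit_ne_zero (S.unit_sig (Bcal_unit hb))), theta]

/-- Functions in `V_χ^{K_n}` are the functions transforming under `Γ₀(p^n)` by `theta`. -/
theorem mem_Vsp_iff (hχ : IsChar χ) (hr : HasDepth S χ r) {n : ℤ} (hn : (r : ℤ) + 1 ≤ n)
    {f : Mat E → ℂ} : f ∈ Vsp S χ n ↔ (∀ x, x ∉ Kset S → f x = 0) ∧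
      ∀ m ∈ Gam S n, ∀ k ∈ Kset S, f (m * k) = theta S χ m * f k := by
  constructor
  · rintro ⟨h0, h1, h2⟩
    refine ⟨h0, fun m hm k hk => ?_⟩
    have hd := unit_of_nonunit hm.1 (hm.2.mono (by omega))
    obtain ⟨b, hb, hbd, hmb, hs⟩ := exists_Bcal_lowU hm.1 hd
    have hl : lowU (m 1 0 / m 1 1) ∈ Kfil S n :=
      lowU_mem_Kfil (by omega) hs (hm.2.div_unit hd)
    have hconj := conj_mem_Kfil (kinv_mem_Kset hk) hl
    rw [kinv_kinv] at hconj
    have h3 : f (lowU (m 1 0 / m 1 1) * k) = f k := by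
      have := h2 k hk _ hconj
      rwa [← Matrix.mul_assoc, ← Matrix.mul_assoc, mul_kinv_self hk, Matrix.one_mul] at this
    conv_lhs => rw [hmb]
    rw [Matrix.mul_assoc, h1 b hb _ (mul_mem_Kset hl.1 hk), h3, theta_Bcal hχ hb, theta, theta,
      hbd]
  · rintro ⟨h0, h1⟩
    refine ⟨h0, fun b hb k hk => ?_, fun k hk g hg => ?_⟩
    · rw [h1 b (Bcal_subset_Gam n hb) k hk, theta_Bcal hχ hb]
    · have hconj := conj_mem_Kfil hk hg
      have := h1 _ (Kfil_subset_Gam hconj) k hk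
      rw [theta_Kfil hχ hr hn hconj, one_mul] at this
      rwa [Matrix.mul_assoc, kinv_mul_self hk, Matrix.mul_one] at this

theorem Vsp_mono {m n : ℤ} (h : m ≤ n) : Vsp S χ m ≤ Vsp S χ n :=
  fun _ hf => ⟨hf.1, hf.2.1, fun k hk g hg => hf.2.2 k hk g (Kfil_mono h hg)⟩

theorem rho_apply (g k : Mat E) (f : Mat E → ℂ) : rho g f k = f (k * g) := rfl

theorem KInvariant_Vsp (n : ℤ) : KInvariant S (Vsp S χ n) := by
  rintro g hg f ⟨h0, h1, h2⟩
  refine ⟨fun x hx => h0 _ fun h => hx ((mul_mem_Kset_iff' hg).1 h), fun b hb k hk => ?_,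
    fun k hk l hl => ?_⟩
  · rw [rho_apply, rho_apply, Matrix.mul_assoc, h1 b hb _ (mul_mem_Kset hk hg)]
  · have hconj := conj_mem_Kfil (kinv_mem_Kset hg) hl
    rw [kinv_kinv] at hconj
    have := h2 _ (mul_mem_Kset hk hg) _ hconj
    rw [rho_apply, rho_apply, ← this]
    congr 1
    rw [Matrix.mul_assoc k g, ← Matrix.mul_assoc g, ← Matrix.mul_assoc g, mul_kinv_self hg,
      Matrix.one_mul, Matrix.mul_assoc]

/-- The functions in `V_χ^{K_n}` on which `𝓑` acts from the right by `χ`. -/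
def Hsp (S : USetting E) (χ : E → ℂ) (n : ℤ) : Set (Mat E → ℂ) :=
  {f | f ∈ Vsp S χ n ∧ ∀ b ∈ Bcal S, rho b f = theta S χ b • f}

theorem upU_mem_Bcal {x : E} (hx : S.sig x = -x) (h : S.Pge 0 x) : upU x ∈ Bcal S :=
  ⟨upU_mem hx h, by simp [upU]⟩

theorem dg_mem_Bcal {e : E} (he : S.nu e = 0) : dg S e ∈ Bcal S := ⟨dg_mem he, by simp [dg]⟩

theorem theta_upU (hχ : IsChar χ) (x : E) : theta S χ (upU x) = 1 := by
  simp [theta, upU, hχ.map_one]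

theorem Vsp.left {n : ℤ} (hχ : IsChar χ) {f : Mat E → ℂ} (hf : f ∈ Vsp S χ n) {b k : Mat E}
    (hb : b ∈ Bcal S) (hk : k ∈ Kset S) : f (b * k) = theta S χ b * f k := by
  rw [hf.2.1 b hb k hk, theta_Bcal hχ hb]

theorem Hsp.right {n : ℤ} {f : Mat E → ℂ} (hf : f ∈ Hsp S χ n) {b : Mat E}
    (hb : b ∈ Bcal S) (k : Mat E) : f (k * b) = theta S χ b * f k :=
  congrFun (hf.2 b hb) k

theorem Hsp.big_cell (hχ : IsChar χ) {n : ℤ} {f : Mat E → ℂ} (hf : f ∈ Hsp S χ n) {k : Mat E}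
    (hk : k ∈ Kset S) (hc : S.nu (k 1 0) = 0) : f k = (χ (S.sig (k 1 0)))⁻¹ * f (w0 E) := by
  obtain ⟨x, y, hx, hy, hx0, hy0, hkk⟩ := _root_.big_cell hk hc
  conv_lhs => rw [hkk]
  rw [Hsp.right hf (upU_mem_Bcal hy hy0), theta_upU hχ, one_mul, Matrix.mul_assoc,
    Vsp.left hχ hf.1 (upU_mem_Bcal hx hx0) (mul_mem_Kset (dg_mem hc) w0_mem), theta_upU hχ,
    one_mul, Vsp.left hχ hf.1 (dg_mem_Bcal hc) w0_mem]
  simp [theta, dg]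

theorem Vsp.small_cell (hχ : IsChar χ) {n : ℤ} {f : Mat E → ℂ} (hf : f ∈ Vsp S χ n)
    {k : Mat E} (hk : k ∈ Kset S) (hd : S.nu (k 1 1) = 0) :
    f k = (χ (S.sig (k 1 1)))⁻¹ * f (lowU (k 1 0 / k 1 1)) := by
  obtain ⟨b, hb, hbd, hkb, hs⟩ := exists_Bcal_lowU hk hd
  conv_lhs => rw [hkb]
  rw [Vsp.left hχ hf hb (lowU_mem hs ((Kset_int hk _ _).div_unit hd)), theta, hbd]

theorem Vsp.lowU_congr {n : ℤ} (hn : 0 ≤ n) {f : Mat E → ℂ} (hf : f ∈ Vsp S χ n)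
    {y y' : E} (hy : S.sig y = -y) (hy' : S.sig y' = -y') (hi : S.Pge 0 y)
    (h : S.Pge n (y' - y)) : f (lowU y') = f (lowU y) := by
  have := hf.2.2 (lowU y) (lowU_mem hy hi) (lowU (y' - y))
    (lowU_mem_Kfil hn (by rw [map_sub, hy, hy']; ring) h)
  rwa [lowU_mul_lowU, add_sub_cancel] at this

theorem sig_norm (a : E) : S.sig (a * S.sig a) = a * S.sig a := by
  rw [map_mul, S.sig_invol, mul_comm]

theorem Hsp.lowU_orbit (hχ : IsChar χ) {n : ℤ} {f : Mat E → ℂ} (hf : f ∈ Hsp S χ n)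
    {y x a : E} (hy : S.sig y = -y) (hx : S.sig x = -x) (hy1 : S.Pge 1 y) (hx0 : S.Pge 0 x)
    (ha : S.nu a = 0) :
    f (lowU y) = (χ (1 + y * x))⁻¹ * f (lowU (y * (a * S.sig a) / (1 + y * x))) := by
  set e := (S.sig a)⁻¹ with he
  have hsa : S.nu (S.sig a) = 0 := S.unit_sig ha
  have he0 : S.nu e = 0 := S.unit_inv hsa
  have hsa0 := S.unit_ne_zero hsa
  have ha0 := S.unit_ne_zero ha
  have hu : S.nu (1 + y * x) = 0 := unit_one_add (hy1.mul_int hx0)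
  have hu0 := S.unit_ne_zero hu
  have hus : S.sig (1 + y * x) = 1 + y * x := by
    rw [map_add, map_mul, hy, hx, _root_.map_one]
    ring
  have hse : S.sig e = a⁻¹ := by rw [he, map_inv₀, S.sig_invol]
  have hk : lowU y * upU x * dg S e ∈ Kset S :=
    mul_mem_Kset (mul_mem_Kset (lowU_mem hy (hy1.mono zero_le_one)) (upU_mem hx hx0)) (dg_mem he0)
  have h10 : (lowU y * upU x * dg S e) 1 0 = y * a := by
    simp [Matrix.mul_apply, Fin.sum_univ_two, lowU, upU, dg, hse]
  have h11 : (lowU y * upU x * dg S e) 1 1 = (1 + y * x) * e := by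
    simp [Matrix.mul_apply, Fin.sum_univ_two, lowU, upU, dg]
    exact Or.inl (add_comm _ _)
  have h1 := Vsp.small_cell hχ hf.1 hk (by rw [h11]; exact S.unit_mul hu he0)
  rw [Hsp.right hf (dg_mem_Bcal he0), Hsp.right hf (upU_mem_Bcal hx hx0), theta_upU hχ, one_mul,
    h10, h11] at h1
  have h2 : theta S χ (dg S e) = χ a := by
    simp [theta, dg, hse, hχ.map_inv ha0]
  have h3 : y * a / ((1 + y * x) * e) = y * (a * S.sig a) / (1 + y * x) := by
    rw [he]
    field_simp
  rw [h2, h3, map_mul, hus, hse, hχ.1 _ _ hu0 (inv_ne_zero ha0), hχ.map_inv ha0, mul_inv,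
    inv_inv] at h1
  refine mul_left_cancel₀ (hχ.2 a ha0) ?_
  rw [h1]
  ring

theorem Hsp.lowU_eq_of_nu (hχ : IsChar χ) {n : ℤ} {f : Mat E → ℂ} (hf : f ∈ Hsp S χ n)
    (hn : 0 ≤ n) {y y' : E} {j : ℤ} (hy : S.sig y = -y) (hy' : S.sig y' = -y') (hj : 1 ≤ j)
    (hyj : S.nu y = j) (hyj' : S.nu y' = j) : f (lowU y) = f (lowU y') := by
  have hy0 := S.ne_zero_of_nu hyj
  have hu : S.sig (y' / y) = y' / y := by rw [map_div₀, hy, hy', neg_div_neg_eq]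
  have hu0 : S.nu (y' / y) = 0 := by
    rw [div_eq_mul_inv, S.nu_mul, hyj', S.nu_inv hyj]
    norm_cast
    omega
  obtain ⟨a, ha, haN⟩ := S.exists_norm hu hu0 n.toNat
  rw [Int.toNat_of_nonneg hn] at haN
  have hyP : S.Pge 1 y := (Pge.of_nu hyj).mono hj
  have h1 := Hsp.lowU_orbit hχ hf hy (x := 0) (by simp) hyP (Pge.zero 0) ha
  rw [mul_zero, add_zero, hχ.map_one, inv_one, one_mul, div_one] at h1
  rw [h1]
  refine Vsp.lowU_congr hn hf.1 hy' ?_ ((Pge.of_nu hyj').mono (by omega)) ?_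
  · rw [map_mul, hy, sig_norm]
    ring
  · have := (hyP.mono zero_le_one).int_mul haN
    convert this using 1
    field_simp

theorem Hsp.lowU_eq_zero (hχ : IsChar χ) {n : ℤ} {f : Mat E → ℂ} (hf : f ∈ Hsp S χ n)
    (hn : 0 ≤ n) (hr : HasTrueDepth S χ r) {y : E} {j : ℤ} (hy : S.sig y = -y) (hj : 1 ≤ j)
    (hjr : j ≤ r) (hyj : S.nu y = j) : f (lowU y) = 0 := by
  have hnt : ¬ TrivOn χ (onePF S (r : ℤ)) := hr.2.resolve_left (by omega)
  unfold TrivOn at hnt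
  push Not at hnt
  obtain ⟨z, ⟨hz, hzr⟩, hχz⟩ := hnt
  have hzP : S.Pge r (z - 1) := hzr
  have hy0 := S.ne_zero_of_nu hyj
  have hz0 : S.nu z = 0 := unit_of_congr S.nu_one (hzP.mono (by omega))
  have hyP : S.Pge 1 y := (Pge.of_nu hyj).mono hj
  obtain ⟨a, ha, haN⟩ := S.exists_norm hz hz0 n.toNat
  rw [Int.toNat_of_nonneg hn] at haN
  have h1 := Hsp.lowU_orbit hχ hf hy (x := (z - 1) / y)
    (by rw [map_div₀, map_sub, hz, hy, _root_.map_one, div_neg]) hyP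
    ((hzP.div_nu hyj).mono (by omega)) ha
  have hyz : 1 + y * ((z - 1) / y) = z := by
    field_simp
    ring
  rw [hyz] at h1
  have h2 : f (lowU (y * (a * S.sig a) / z)) = f (lowU y) := by
    refine Vsp.lowU_congr hn hf.1 hy ?_ (hyP.mono zero_le_one) ?_
    · rw [map_div₀, map_mul, hy, sig_norm, hz]
      ring
    · have := ((hyP.mono zero_le_one).int_mul haN).div_unit hz0
      have hz0' := S.unit_ne_zero hz0
      convert this using 1
      field_simp
  rw [h2] at h1
  by_contra hne
  have h3 : (χ z)⁻¹ = 1 := (mul_eq_right₀ hne).1 h1.symm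
  exact hχz (inv_eq_one.1 h3)

theorem Hsp.w0_eq_zero (hχ : IsChar χ) (hr : HasDepth S χ r) {n : ℤ} {f : Mat E → ℂ}
    (hf : f ∈ Hsp S χ n) (hnt : ∃ x ∈ OFunits S, χ x ≠ 1) : f (w0 E) = 0 := by
  obtain ⟨u, ⟨hu, hu0⟩, hχu⟩ := hnt
  obtain ⟨a, ha, haN⟩ := S.exists_norm hu hu0 (r + 1)
  have h1 : χ (a * S.sig a) = χ u := hr.congr hχ (le_refl _) hu0 (by exact_mod_cast haN)
  have ha0 := S.unit_ne_zero ha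
  have hsa0 := S.unit_ne_zero (S.unit_sig ha)
  have he0 : S.nu (S.sig a)⁻¹ = 0 := S.unit_inv (S.unit_sig ha)
  have h2 := Hsp.right hf (dg_mem_Bcal he0) (w0 E)
  have hse : S.sig (S.sig a)⁻¹ = a⁻¹ := by rw [map_inv₀, S.sig_invol]
  have h3 : w0 E * dg S (S.sig a)⁻¹ = dg S a * w0 E := by
    ext i j
    fin_cases i <;> fin_cases j <;> simp [w0, dg, S.sig_invol]
  rw [h3, Vsp.left hχ hf.1 (dg_mem_Bcal ha) w0_mem] at h2
  have h4 : theta S χ (dg S (S.sig a)⁻¹) = χ a := by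
    simp [theta, dg, S.sig_invol, hχ.map_inv ha0]
  have h5 : theta S χ (dg S a) = (χ (S.sig a))⁻¹ := by simp [theta, dg]
  rw [h4, h5] at h2
  by_contra hne
  have h6 := mul_right_cancel₀ hne h2
  refine hχu ?_
  rw [← h1, hχ.1 _ _ ha0 hsa0, ← h6, inv_mul_cancel₀ (hχ.2 _ hsa0)]

/-- A vector of `Hsp` taking equal values at `1` and at a lower unipotent of level `d` already has
level `d`. -/
theorem Hsp.mem_Vsp (hχ : IsChar χ) (hr : HasDepth S χ r) {d : ℤ} (hd : (r : ℤ) + 1 ≤ d)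
    {f : Mat E → ℂ} (hf : f ∈ Hsp S χ (d + 1)) {y₀ : E} (hy₀ : S.sig y₀ = -y₀)
    (hy₀d : S.nu y₀ = d) (h : f 1 = f (lowU y₀)) : f ∈ Vsp S χ d := by
  have hval : ∀ y, S.sig y = -y → S.Pge d y → f (lowU y) = f 1 := by
    intro y hy hyd
    by_cases hy1 : S.Pge (d + 1) y
    · rw [← lowU_zero]
      exact Vsp.lowU_congr (by omega) hf.1 (by simp) hy (Pge.zero 0) (by simpa using hy1)
    · have hne : y ≠ 0 := by
        rintro rfl
        exact hy1 (Pge.zero _)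
      obtain ⟨j, hj⟩ := S.nu_eq_int hne
      have hjd : j = d := by
        have h1 := hyd.le hj
        by_contra h2
        exact hy1 ((Pge.of_nu hj).mono (by omega))
      subst hjd
      rw [h]
      exact Hsp.lowU_eq_of_nu hχ hf (by omega) hy hy₀ (by omega) hj hy₀d
  have hlow : ∀ y, S.sig y = -y → S.Pge d y → ∀ k ∈ Kset S, f (lowU y * k) = f k := by
    intro y hy hyd k hk
    have hyk : lowU y * k ∈ Kset S := mul_mem_Kset (lowU_mem hy (hyd.mono (by omega))) hk
    have h10 : S.Pge d ((lowU y * k) 1 0 - k 1 0) := by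
      have : (lowU y * k) 1 0 - k 1 0 = y * k 0 0 := by
        simp [Matrix.mul_apply, Fin.sum_univ_two, lowU]
      rw [this]
      exact hyd.mul_int (Kset_int hk _ _)
    have h11 : S.Pge d ((lowU y * k) 1 1 - k 1 1) := by
      have : (lowU y * k) 1 1 - k 1 1 = y * k 0 1 := by
        simp [Matrix.mul_apply, Fin.sum_univ_two, lowU]
      rw [this]
      exact hyd.mul_int (Kset_int hk _ _)
    generalize hk' : lowU y * k = k' at hyk h10 h11
    rcases (Kset_int hk 1 0).unit_or with hc | hc
    · have hc' : S.nu (k' 1 0) = 0 := unit_of_congr hc (h10.mono (by omega))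
      rw [Hsp.big_cell hχ hf hk hc, Hsp.big_cell hχ hf hyk hc', hr.congr hχ hd (S.unit_sig hc)
        (by rw [← map_sub]; exact h10.sig)]
    · have hdk := unit_of_nonunit hk hc
      have hdk' : S.nu (k' 1 1) = 0 := unit_of_congr hdk (h11.mono (by omega))
      have hdk0 := S.unit_ne_zero hdk
      have hdk0' := S.unit_ne_zero hdk'
      rw [Vsp.small_cell hχ hf.1 hk hdk, Vsp.small_cell hχ hf.1 hyk hdk',
        hr.congr hχ hd (S.unit_sig hdk) (by rw [← map_sub]; exact h11.sig)]
      congr 1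
      have hs := skew_div hdk0 (Kset_row_isotropic hk)
      have hs' := skew_div hdk0' (Kset_row_isotropic hyk)
      have hdiff : S.Pge d (k' 1 0 / k' 1 1 - k 1 0 / k 1 1) := by
        have h1 : k' 1 0 / k' 1 1 - k 1 0 / k 1 1 =
            ((k' 1 0 - k 1 0) * k 1 1 - k 1 0 * (k' 1 1 - k 1 1)) / (k' 1 1 * k 1 1) := by
          field_simp
          ring
        rw [h1]
        exact ((h10.mul_int (Kset_int hk _ _)).sub ((Kset_int hk _ _).int_mul h11)).div_unit
          (S.unit_mul hdk' hdk)
      by_cases hsd : S.Pge d (k 1 0 / k 1 1)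
      · have hsd' : S.Pge d (k' 1 0 / k' 1 1) := by
          have := hdiff.add hsd
          rwa [sub_add_cancel] at this
        rw [hval _ hs hsd, hval _ hs' hsd']
      · have hne : k 1 0 / k 1 1 ≠ 0 := by
          intro h0
          rw [h0] at hsd
          exact hsd (Pge.zero _)
        obtain ⟨j, hj⟩ := S.nu_eq_int hne
        have hjd : j < d := by
          by_contra h2
          exact hsd ((Pge.of_nu hj).mono (by omega))
        exact (Hsp.lowU_eq_of_nu hχ hf (by omega) hs hs' ((hc.div_unit hdk).le hj) hj
          (nu_of_congr hj hdiff hjd)).symm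
  rw [mem_Vsp_iff hχ hr hd]
  refine ⟨hf.1.1, fun m hm k hk => ?_⟩
  have hmd := unit_of_nonunit hm.1 (hm.2.mono (by omega))
  obtain ⟨b, hb, hbd, hmb, hs⟩ := exists_Bcal_lowU hm.1 hmd
  have hP := hm.2.div_unit hmd
  conv_lhs => rw [hmb]
  rw [Matrix.mul_assoc, Vsp.left hχ hf.1 hb (mul_mem_Kset (lowU_mem hs (hP.mono (by omega))) hk),
    hlow _ hs hP k hk, theta, theta, hbd]

theorem Hsp.eq_zero (hχ : IsChar χ) (hr : MinDepth S χ r) (hnt : ∃ x ∈ OFunits S, χ x ≠ 1)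
    {f : Mat E → ℂ} (hf : f ∈ Hsp S χ ((r : ℤ) + 1)) (h : f 1 = 0) : f = 0 := by
  funext k
  by_cases hk : k ∈ Kset S
  swap
  · exact hf.1.1 k hk
  rcases (Kset_int hk 1 0).unit_or with hc | hc
  · rw [Hsp.big_cell hχ hf hk hc, Hsp.w0_eq_zero hχ hr.1 hf hnt, mul_zero]
    rfl
  · have hd := unit_of_nonunit hk hc
    have hs := skew_div (S.unit_ne_zero hd) (Kset_row_isotropic hk)
    rw [Vsp.small_cell hχ hf.1 hk hd]
    refine mul_eq_zero_of_right _ ?_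
    by_cases hP : S.Pge (r + 1) (k 1 0 / k 1 1)
    · rw [← h, ← lowU_zero]
      exact Vsp.lowU_congr (by omega) hf.1 (by simp) hs (Pge.zero 0) (by simpa using hP)
    · have hne : k 1 0 / k 1 1 ≠ 0 := by
        intro h0
        rw [h0] at hP
        exact hP (Pge.zero _)
      obtain ⟨j, hj⟩ := S.nu_eq_int hne
      refine Hsp.lowU_eq_zero hχ hf (by omega) hr.2 hs ((hc.div_unit hd).le hj) ?_ hj
      by_contra h2
      exact hP ((Pge.of_nu hj).mono (by omega))

end Functions

section Averaging

variable {S : USetting E} {χ : E → ℂ} {r : ℕ}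

theorem coe_units_inv {u : (Mat E)ˣ} (hu : (u : Mat E) ∈ Kset S) :
    ((u⁻¹ : (Mat E)ˣ) : Mat E) = kinv S u :=
  Units.inv_eq_of_mul_eq_one_right (mul_kinv_self hu)

/-- The subgroup of invertible matrices attached to a subset of `K` closed under the group
operations. -/
def unitsSubgroup (S : USetting E) (A : Set (Mat E)) (hK : A ⊆ Kset S) (h1 : 1 ∈ A)
    (hmul : ∀ x ∈ A, ∀ y ∈ A, x * y ∈ A) (hinv : ∀ x ∈ A, kinv S x ∈ A) :
    Subgroup (Mat E)ˣ where
  carrier := {u | (u : Mat E) ∈ A}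
  one_mem' := h1
  mul_mem' := fun {x y} hx hy => hmul x hx y hy
  inv_mem' := fun {x} hx => by
    change ((x⁻¹ : (Mat E)ˣ) : Mat E) ∈ A
    rw [coe_units_inv (hK hx)]
    exact hinv x hx

/-- `Γ₀(p^n)` as a group. -/
def GamGroup (S : USetting E) (n : ℤ) : Subgroup (Mat E)ˣ :=
  unitsSubgroup S (Gam S n) (fun _ h => h.1) (one_mem_Gam n) (fun _ hx _ hy => mul_mem_Gam hx hy)
    fun _ hx => kinv_mem_Gam hx

/-- `K_n` as a group. -/
def KfilGroup (S : USetting E) (n : ℤ) : Subgroup (Mat E)ˣ :=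
  unitsSubgroup S (Kfil S n) (fun _ h => h.1)
    ⟨one_mem_Kset, fun i j => by
      change S.Pge n _
      rw [sub_self]
      exact Pge.zero n⟩
    (fun x hx y hy => by
      have := kinv_mul_mem_Kfil (n := n) (kinv_mem_Kset hx.1) hy.1 (fun i j => by
        have h1 := hy.2 i j
        have h2 := (kinv_mul_mem_Kfil (n := n) hx.1 one_mem_Kset (fun i j => by
          have h3 := Pge.neg (hx.2 i j)
          rwa [← Matrix.neg_apply, neg_sub] at h3)).2 i j
        rw [Matrix.mul_one] at h2
        have h4 := Pge.sub h1 h2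
        rwa [← Matrix.sub_apply, sub_sub_sub_cancel_right] at h4)
      rwa [kinv_kinv] at this)
    fun x hx => by
      have := kinv_mul_mem_Kfil (n := n) hx.1 one_mem_Kset (fun i j => by
        have h3 := Pge.neg (hx.2 i j)
        rwa [← Matrix.neg_apply, neg_sub] at h3)
      rwa [Matrix.mul_one] at this

/-- `𝓑` as a group. -/
def BGroup (S : USetting E) : Subgroup (Mat E)ˣ :=
  unitsSubgroup S (Bcal S) (fun _ h => h.1) ⟨one_mem_Kset, by simp⟩
    (fun x hx y hy => ⟨mul_mem_Kset hx.1 hy.1, by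
      rw [Matrix.mul_apply, Fin.sum_univ_two, hx.2, hy.2]
      ring⟩)
    fun x hx => ⟨kinv_mem_Kset hx.1, by simp [kinv, hx.2]⟩

theorem mem_GamGroup {n : ℤ} {u : (Mat E)ˣ} : u ∈ GamGroup S n ↔ (u : Mat E) ∈ Gam S n := Iff.rfl

theorem mem_BGroup {u : (Mat E)ˣ} : u ∈ BGroup S ↔ (u : Mat E) ∈ Bcal S := Iff.rfl

/-- Integers of `E` fall into finitely many classes modulo `p_E^n`. -/
theorem exists_finite_reduction (S : USetting E) (n : ℕ) : ∃ (ι : Type) (_ : Finite ι)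
    (red : E → ι), ∀ x y, S.Pge 0 x → S.Pge 0 y → red x = red y → S.Pge n (x - y) := by
  obtain ⟨R, -, hR, hu⟩ := S.exists_residues n
  have h2 := S.nonzero_two
  have he := S.sqeps_ne_zero
  have hre : ∀ x, S.sig ((x + S.sig x) / 2) = (x + S.sig x) / 2 := fun x => by
    rw [map_div₀, map_add, S.sig_invol, map_ofNat, add_comm]
  have him : ∀ x, S.sig ((x - S.sig x) / (2 * S.sqeps)) = (x - S.sig x) / (2 * S.sqeps) :=
    fun x => by
      rw [map_div₀, map_sub, map_mul, S.sig_invol, map_ofNat, S.sig_sqeps]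
      field_simp
      ring
  have hre0 : ∀ x, S.Pge 0 x → S.Pge 0 ((x + S.sig x) / 2) :=
    fun x hx => (hx.add hx.sig).div_unit S.nu_two
  have him0 : ∀ x, S.Pge 0 x → S.Pge 0 ((x - S.sig x) / (2 * S.sqeps)) :=
    fun x hx => (hx.sub hx.sig).div_unit (S.unit_mul S.nu_two S.nu_sqeps)
  have hrep : ∃ ρ : E → R, ∀ y, S.sig y = y → S.Pge 0 y → S.Pge n (y - ρ y) := by
    have hne : Nonempty R := by
      obtain ⟨x, ⟨hx, -⟩, -⟩ := hu 0 (map_zero _) (Pge.zero 0)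
      exact ⟨⟨x, hx⟩⟩
    have : ∀ y, ∃ z : R, S.sig y = y → S.Pge 0 y → S.Pge n (y - z) := by
      intro y
      by_cases h : S.sig y = y ∧ S.Pge 0 y
      · obtain ⟨x, ⟨hx, hxy⟩, -⟩ := hu y h.1 h.2
        exact ⟨⟨x, hx⟩, fun _ _ => hxy⟩
      · exact ⟨hne.some, fun h1 h2 => absurd ⟨h1, h2⟩ h⟩
    exact ⟨fun y => (this y).choose, fun y => (this y).choose_spec⟩
  obtain ⟨ρ, hρ⟩ := hrep
  refine ⟨R × R, inferInstance,
    fun x => (ρ ((x + S.sig x) / 2), ρ ((x - S.sig x) / (2 * S.sqeps))), fun x y hx hy hxy => ?_⟩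
  obtain ⟨h3, h4⟩ := Prod.ext_iff.1 hxy
  simp only at h3 h4
  have h5 := (hρ _ (hre x) (hre0 x hx)).sub (hρ _ (hre y) (hre0 y hy))
  have h6 := (hρ _ (him x) (him0 x hx)).sub (hρ _ (him y) (him0 y hy))
  rw [h3, sub_sub_sub_cancel_right] at h5
  rw [h4, sub_sub_sub_cancel_right] at h6
  have := h5.add (h6.mul_int (Pge.of_unit S.nu_sqeps))
  convert this using 1
  field_simp
  ring

theorem finite_quotient {H : Subgroup (Mat E)ˣ} (hH : ∀ h ∈ H, (h : Mat E) ∈ Kset S) (n : ℕ)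
    {L : Subgroup H} (hL : ∀ h : H, ((h : (Mat E)ˣ) : Mat E) ∈ Kfil S n → h ∈ L) :
    Finite (H ⧸ L) := by
  obtain ⟨ι, _, red, hred⟩ := exists_finite_reduction S n
  refine Finite.of_injective
    (fun (c : H ⧸ L) (i j : Fin 2) => red ((((c.out : H) : (Mat E)ˣ) : Mat E) i j)) ?_
  intro c c' hcc
  have hc := hH _ c.out.2
  have hc' := hH _ c'.out.2
  rw [← c.out_eq', ← c'.out_eq']
  refine QuotientGroup.eq.2 (hL _ ?_)
  rw [Subgroup.coe_mul, Subgroup.coe_inv, Units.val_mul, coe_units_inv hc]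
  exact kinv_mul_mem_Kfil hc hc' fun i j =>
    hred _ _ (Kset_int hc' i j) (Kset_int hc i j) (congrFun (congrFun hcc i) j).symm

theorem sum_quotient_mul_left {H A : Type*} [Group H] [AddCommMonoid A] (L : Subgroup H)
    [Fintype (H ⧸ L)] (F : H → A) (hF : ∀ h, ∀ l ∈ L, F (h * l) = F h) (g : H) :
    ∑ c : H ⧸ L, F (g * c.out) = ∑ c : H ⧸ L, F c.out := by
  let F' : H ⧸ L → A := Quotient.lift F fun a b hab => by
    have h := hF a _ (QuotientGroup.leftRel_apply.1 hab)
    rw [mul_inv_cancel_left] at h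
    exact h.symm
  have h1 : ∀ c : H ⧸ L, F c.out = F' c := fun c => by
    conv_rhs => rw [← c.out_eq']
    rfl
  have h2 : ∀ c : H ⧸ L, F (g * c.out) = F' (g • c) := fun c => by
    conv_rhs => rw [← c.out_eq']
    rfl
  simp only [h1, h2]
  exact Equiv.sum_comp (MulAction.toPerm g) F'

theorem rho_mul (g h : Mat E) (f : Mat E → ℂ) : rho (g * h) f = rho g (rho h f) := by
  funext k
  simp only [rho_apply, Matrix.mul_assoc]

theorem rho_Kfil {n : ℤ} {f : Mat E → ℂ} (hf : f ∈ Vsp S χ n) {g : Mat E} (hg : g ∈ Kfil S n) :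
    rho g f = f := by
  funext k
  rw [rho_apply]
  by_cases hk : k ∈ Kset S
  · exact hf.2.2 k hk g hg
  · rw [hf.1 k hk, hf.1 _ fun h => hk ((mul_mem_Kset_iff' hg.1).1 h)]

/-- Averaging over `𝓑` against the character. -/
theorem exists_mem_Hsp (hχ : IsChar χ) (hr : HasDepth S χ r) {n : ℕ} (hn : r + 1 ≤ n)
    {U : Submodule ℂ (Mat E → ℂ)} (hU : KInvariant S U) (hUV : U ≤ Vsp S χ n)
    {f : Mat E → ℂ} (hf : f ∈ U) (hf1 : f 1 ≠ 0) : ∃ f' ∈ U, f' ∈ Hsp S χ n ∧ f' ≠ 0 := by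
  have hn' : (r : ℤ) + 1 ≤ n := by exact_mod_cast hn
  let L := (KfilGroup S n).subgroupOf (BGroup S)
  have : Finite (BGroup S ⧸ L) := finite_quotient (S := S) (H := BGroup S)
    (fun h hh => (mem_BGroup.1 hh).1) n fun h hh =>
    Subgroup.mem_subgroupOf.2 hh
  have := Fintype.ofFinite (BGroup S ⧸ L)
  let F : BGroup S → Mat E → ℂ := fun b => (theta S χ (b : (Mat E)ˣ))⁻¹ • rho (b : (Mat E)ˣ) f
  have hB : ∀ b : BGroup S, ((b : (Mat E)ˣ) : Mat E) ∈ Bcal S := fun b => b.2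
  have hG : ∀ b : BGroup S, ((b : (Mat E)ˣ) : Mat E) ∈ Gam S n :=
    fun b => Bcal_subset_Gam n (hB b)
  have hF : ∀ b, ∀ l ∈ L, F (b * l) = F b := by
    intro b l hl
    have hl' : ((l : (Mat E)ˣ) : Mat E) ∈ Kfil S n := Subgroup.mem_subgroupOf.1 hl
    simp only [F, Subgroup.coe_mul, Units.val_mul]
    rw [theta_mul hχ hr hn' (hG b) (hG l), theta_Kfil hχ hr hn' hl', mul_one, rho_mul,
      rho_Kfil (hUV hf) hl']
  have hmem : ∑ c : BGroup S ⧸ L, F c.out ∈ U :=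
    U.sum_mem fun c _ => U.smul_mem _ (hU _ (hB _).1 f hf)
  refine ⟨_, hmem, ⟨hUV hmem, fun b hb => ?_⟩, fun h0 => ?_⟩
  · let u : (Mat E)ˣ := ⟨b, kinv S b, mul_kinv_self hb.1, kinv_mul_self hb.1⟩
    let b' : BGroup S := ⟨u, hb⟩
    have h := sum_quotient_mul_left L F hF b'
    conv_rhs => rw [← h]
    rw [map_sum, Finset.smul_sum]
    refine Finset.sum_congr rfl fun c _ => ?_
    have hθ : theta S χ b ≠ 0 := theta_ne_zero hχ (Bcal_subset_Gam 1 hb)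
    simp only [F, Subgroup.coe_mul, Units.val_mul]
    change _ = theta S χ b • (theta S χ (b * _))⁻¹ • rho (b * _) f
    rw [theta_mul hχ hr hn' (Bcal_subset_Gam n hb) (hG _), rho_mul, smul_smul, mul_inv,
      mul_inv_cancel_left₀ hθ, _root_.map_smul]
  · have h1 := congrFun h0 1
    rw [Finset.sum_apply] at h1
    have h2 : ∀ c : BGroup S ⧸ L, F c.out 1 = f 1 := by
      intro c
      have hθ : theta S χ ((c.out : BGroup S) : (Mat E)ˣ) ≠ 0 :=
        theta_ne_zero hχ (Bcal_subset_Gam 1 (hB _))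
      have h3 := Vsp.left hχ (hUV hf) (hB c.out) one_mem_Kset
      simp only [F, Pi.smul_apply, rho_apply, smul_eq_mul]
      rw [Matrix.one_mul, ← Matrix.mul_one (((c.out : BGroup S) : (Mat E)ˣ) : Mat E), h3,
        Matrix.mul_one, inv_mul_cancel_left₀ hθ]
    simp only [h2, Finset.sum_const, Finset.card_univ, nsmul_eq_mul, Pi.zero_apply] at h1
    rcases mul_eq_zero.1 h1 with h3 | h3
    · exact Fintype.card_ne_zero (Nat.cast_eq_zero.1 h3)
    · exact hf1 h3

/-- Averaging over `Γ₀(p^d)/Γ₀(p^{d+1})` gives an invariant complement. -/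
theorem exists_Wcompl (hχ : IsChar χ) (hr : HasDepth S χ r) {d : ℕ} (hd : r + 1 ≤ d) :
    ∃ W, Wcompl S χ d W := by
  have hd0 : (r : ℤ) + 1 ≤ d := by exact_mod_cast hd
  have hd1 : (r : ℤ) + 1 ≤ (d : ℤ) + 1 := by omega
  let H := GamGroup S d
  let L := (GamGroup S ((d : ℤ) + 1)).subgroupOf H
  have : Finite (H ⧸ L) := finite_quotient (S := S) (H := H)
    (fun h hh => (mem_GamGroup.1 hh).1) (d + 1) fun h hh =>
    Subgroup.mem_subgroupOf.2 (Kfil_subset_Gam (by exact_mod_cast hh))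
  have := Fintype.ofFinite (H ⧸ L)
  have hH : ∀ m : H, ((m : (Mat E)ˣ) : Mat E) ∈ Gam S d := fun m => m.2
  let F : (Mat E → ℂ) → Mat E → H → ℂ := fun f k m =>
    theta S χ (m : (Mat E)ˣ) * f (kinv S (m : (Mat E)ˣ) * k)
  let A : (Mat E → ℂ) →ₗ[ℂ] (Mat E → ℂ) :=
    { toFun := fun f k => ∑ c : H ⧸ L, F f k c.out
      map_add' := fun f g => by
        funext k
        simp only [F, Pi.add_apply, mul_add, Finset.sum_add_distrib]
      map_smul' := fun a f => by
        funext k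
        simp only [F, Pi.smul_apply, smul_eq_mul, RingHom.id_apply, Finset.mul_sum]
        exact Finset.sum_congr rfl fun c _ => by ring }
  have hA : ∀ f k, A f k = ∑ c : H ⧸ L, F f k c.out := fun _ _ => rfl
  have hrho : ∀ g f, A (rho g f) = rho g (A f) := fun g f => by
    funext k
    simp only [rho_apply, hA, F, Matrix.mul_assoc]
  have hAV : ∀ f ∈ Vsp S χ ((d : ℤ) + 1), A f ∈ Vsp S χ d := by
    intro f hf
    have hf' := (mem_Vsp_iff hχ hr hd1).1 hf
    have hF : ∀ k ∈ Kset S, ∀ m, ∀ l ∈ L, F f k (m * l) = F f k m := by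
      intro k hk m l hl
      have hl' : ((l : (Mat E)ˣ) : Mat E) ∈ Gam S ((d : ℤ) + 1) := Subgroup.mem_subgroupOf.1 hl
      simp only [F, Subgroup.coe_mul, Units.val_mul]
      rw [theta_mul hχ hr hd0 (hH m) (hH l), kinv_mul_rev, Matrix.mul_assoc,
        hf'.2 _ (kinv_mem_Gam hl') _ (mul_mem_Kset (kinv_mem_Kset (hH m).1) hk)]
      linear_combination theta S χ (m : (Mat E)ˣ) * f (kinv S (m : (Mat E)ˣ) * k) *
        theta_kinv hχ hr hd1 hl'
    rw [mem_Vsp_iff hχ hr hd0]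
    refine ⟨fun x hx => ?_, fun m hm k hk => ?_⟩
    · refine Finset.sum_eq_zero fun c _ => mul_eq_zero_of_right _ (hf'.1 _ fun h => hx ?_)
      exact (mul_mem_Kset_iff (kinv_mem_Kset (hH _).1)).1 h
    · let u : (Mat E)ˣ := ⟨m, kinv S m, mul_kinv_self hm.1, kinv_mul_self hm.1⟩
      let m' : H := ⟨u, hm⟩
      rw [hA, ← sum_quotient_mul_left L _ (hF _ (mul_mem_Kset hm.1 hk)) m', hA, Finset.mul_sum]
      refine Finset.sum_congr rfl fun c _ => ?_
      simp only [F, Subgroup.coe_mul, Units.val_mul]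
      change theta S χ (m * _) * f (kinv S (m * _) * (m * k)) = _
      rw [theta_mul hχ hr hd0 hm (hH _), kinv_mul_rev, Matrix.mul_assoc,
        ← Matrix.mul_assoc (kinv S m), kinv_mul_self hm.1, Matrix.one_mul, mul_assoc]
  have hAd : ∀ f ∈ Vsp S χ d, A f = (Fintype.card (H ⧸ L) : ℂ) • f := by
    intro f hf
    have hf' := (mem_Vsp_iff hχ hr hd0).1 hf
    funext k
    by_cases hk : k ∈ Kset S
    · rw [hA, Finset.sum_congr rfl (g := fun _ => f k), Finset.sum_const, Finset.card_univ,
        Pi.smul_apply, nsmul_eq_mul, smul_eq_mul]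
      intro c _
      simp only [F]
      rw [hf'.2 _ (kinv_mem_Gam (hH _)) k hk]
      linear_combination f k * theta_kinv hχ hr hd0 (hH c.out)
    · have h1 := (hAV f (Vsp_mono (by omega) hf)).1 k hk
      rw [h1, Pi.smul_apply, hf.1 k hk, smul_zero]
  have hcard : (Fintype.card (H ⧸ L) : ℂ) ≠ 0 := Nat.cast_ne_zero.2 Fintype.card_ne_zero
  refine ⟨Vsp S χ ((d : ℤ) + 1) ⊓ LinearMap.ker A, inf_le_left, ?_, ?_, ?_⟩
  · rintro g hg f ⟨hf, hfA⟩
    refine ⟨KInvariant_Vsp _ g hg f hf, ?_⟩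
    change A (rho g f) = 0
    rw [hrho, show A f = 0 from hfA, map_zero]
  · rw [eq_bot_iff]
    rintro f ⟨hf, -, hfA⟩
    have h1 := hAd f hf
    rw [show A f = 0 from hfA] at h1
    exact (smul_eq_zero.1 h1.symm).resolve_left hcard
  · refine le_antisymm (sup_le (Vsp_mono (by omega)) inf_le_left) fun f hf => ?_
    have h1 : (Fintype.card (H ⧸ L) : ℂ)⁻¹ • A f ∈ Vsp S χ d :=
      Submodule.smul_mem _ _ (hAV f hf)
    refine Submodule.mem_sup.2 ⟨_, h1, f - (Fintype.card (H ⧸ L) : ℂ)⁻¹ • A f, ⟨?_, ?_⟩, ?_⟩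
    · exact Submodule.sub_mem _ hf (Vsp_mono (by omega) h1)
    · change A _ = 0
      rw [map_sub, hAd _ h1, smul_inv_smul₀ hcard, sub_self]
    · rw [add_sub_cancel]

end Averaging

section Representatives

variable {S : USetting E} {χ : E → ℂ} {r : ℕ}

/-- The representative `w₀ · upU y` of the big cell. -/
def bigRep (y : E) : Mat E := !![0, 1; 1, y]

theorem bigRep_mem {y : E} (hy : S.sig y = -y) (h : S.Pge 0 y) : bigRep y ∈ Kset S := by
  refine mem_Kset_iff.2 ⟨?_, fun i j => ?_⟩
  · ext i j
    fin_cases i <;> fin_cases j <;> simp [kinv, bigRep, hy]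
  · fin_cases i <;> fin_cases j <;> simp [bigRep, Pge.one, Pge.zero, h]

theorem mul_kinv_lower (k x : Mat E) :
    (k * kinv S x) 1 0 = k 1 0 * S.sig (x 1 1) + k 1 1 * S.sig (x 1 0) := by
  simp [kinv, Matrix.mul_apply, Fin.sum_univ_two]

/-- Representatives of the right cosets of `Γ₀(p^{N+1})` in `K`. -/
theorem exists_coset_reps (S : USetting E) (N : ℕ) : ∃ (ι : Type) (_ : Fintype ι) (x : ι → Mat E),
    Fintype.card ι = (S.q + 1) * S.q ^ N ∧ (∀ i, x i ∈ Kset S) ∧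
    (∀ k ∈ Kset S, ∃ i, k * kinv S (x i) ∈ Gam S ((N : ℤ) + 1)) ∧
    ∀ i j, x i * kinv S (x j) ∈ Gam S ((N : ℤ) + 1) → i = j := by
  obtain ⟨R, hRc, hR, hRu⟩ := S.exists_residues (N + 1)
  obtain ⟨T, hTc, hT, hTu⟩ := S.exists_residues N
  have he := S.sqeps_ne_zero
  have hp := S.pi_ne_zero
  have hpe : S.nu (S.pi * S.sqeps) = ((1 : ℤ) : WithTop ℤ) := by
    rw [S.nu_mul, S.nu_pi, S.nu_sqeps, add_zero]
    rfl
  have hpi : S.Pge 1 S.pi := Pge.of_nu (n := 1) S.nu_pi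
  have he0 : S.Pge 0 S.sqeps := Pge.of_unit S.nu_sqeps
  have hRs : ∀ s ∈ R, S.sig (s * S.sqeps) = -(s * S.sqeps) := fun s hs => by
    rw [map_mul, S.sig_sqeps, (hR s hs).1, mul_neg]
  have hTs : ∀ s ∈ T, S.sig (S.pi * s * S.sqeps) = -(S.pi * s * S.sqeps) := fun s hs => by
    rw [map_mul, map_mul, S.sig_sqeps, S.sig_pi, (hT s hs).1, mul_neg]
  have hTp : ∀ s ∈ T, S.Pge 1 (S.pi * s * S.sqeps) := fun s hs =>
    (hpi.mul_int (hT s hs).2).mul_int he0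
  have hN : ((N + 1 : ℕ) : ℤ) = (N : ℤ) + 1 := by push_cast; ring
  have hRR : ∀ s ∈ R, ∀ t ∈ R, S.Pge ((N : ℤ) + 1) (s - t) → s = t := fun s hs t ht h =>
    (hRu s (hR s hs).1 (hR s hs).2).unique
      ⟨hs, by rw [sub_self]; exact Pge.zero _⟩ ⟨ht, hN ▸ h⟩
  have hTT : ∀ s ∈ T, ∀ t ∈ T, S.Pge N (s - t) → s = t := fun s hs t ht h =>
    (hTu s (hT s hs).1 (hT s hs).2).unique ⟨hs, by rw [sub_self]; exact Pge.zero _⟩ ⟨ht, h⟩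
  let x : R ⊕ T → Mat E :=
    Sum.elim (fun s => bigRep (s * S.sqeps)) fun s => lowU (S.pi * s * S.sqeps)
  have hx : ∀ i, x i ∈ Kset S := by
    rintro (⟨s, hs⟩ | ⟨s, hs⟩)
    · exact bigRep_mem (hRs s hs) ((hR s hs).2.mul_int he0)
    · exact lowU_mem (hTs s hs) ((hTp s hs).mono zero_le_one)
  refine ⟨R ⊕ T, inferInstance, x, ?_, hx, fun k hk => ?_, ?_⟩
  · rw [Fintype.card_sum, Fintype.card_coe, Fintype.card_coe, hRc, hTc]
    ring
  · rcases (Kset_int hk 1 0).unit_or with hc | hc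
    · have hc0 := S.unit_ne_zero hc
      have h1 := skew_div hc0 ((add_comm _ _).trans (Kset_row_isotropic hk))
      obtain ⟨s, ⟨hs, hsp⟩, -⟩ := hRu (k 1 1 / k 1 0 / S.sqeps)
        (by rw [map_div₀, h1, S.sig_sqeps, neg_div_neg_eq])
        (((Kset_int hk 1 1).div_unit hc).div_unit S.nu_sqeps)
      refine ⟨Sum.inl ⟨s, hs⟩, mul_mem_Kset hk (kinv_mem_Kset (hx _)), ?_⟩
      rw [mul_kinv_lower]
      have h2 := (hsp.mul_int he0).mul_int (Kset_int hk 1 0)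
      rw [hN] at h2
      convert h2 using 1
      simp only [x, Sum.elim_inl, bigRep, Matrix.of_apply, Matrix.cons_val', Matrix.cons_val_zero,
        Matrix.cons_val_one, Matrix.cons_val_fin_one, hRs s hs, _root_.map_one]
      field_simp
      ring
    · have hd := unit_of_nonunit hk hc
      have hd0 := S.unit_ne_zero hd
      have h1 := skew_div hd0 (Kset_row_isotropic hk)
      obtain ⟨s, ⟨hs, hsp⟩, -⟩ := hTu (k 1 0 / k 1 1 / (S.pi * S.sqeps))
        (by rw [map_div₀, h1, map_mul, S.sig_sqeps, S.sig_pi, mul_neg, neg_div_neg_eq])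
        (by simpa using (hc.div_unit hd).div_nu hpe)
      refine ⟨Sum.inr ⟨s, hs⟩, mul_mem_Kset hk (kinv_mem_Kset (hx _)), ?_⟩
      rw [mul_kinv_lower]
      have h2 := (hsp.mul (Pge.of_nu hpe)).mul_int (Kset_int hk 1 1)
      convert h2 using 1
      simp only [x, Sum.elim_inr, lowU, Matrix.of_apply, Matrix.cons_val', Matrix.cons_val_zero,
        Matrix.cons_val_one, Matrix.cons_val_fin_one, hTs s hs, _root_.map_one]
      field_simp
      ring
  · have hcross : ∀ y z, S.Pge 0 y → S.Pge 1 z → ¬ S.Pge ((N : ℤ) + 1) (1 + y * z) :=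
      fun y z hy hz h => (h.mono (by omega)).not_unit (unit_one_add (hy.int_mul hz))
    rintro (⟨s, hs⟩ | ⟨s, hs⟩) (⟨t, ht⟩ | ⟨t, ht⟩) ⟨-, h⟩ <;> rw [mul_kinv_lower] at h <;>
      simp only [x, Sum.elim_inr, Sum.elim_inl, lowU, bigRep, Matrix.of_apply, Matrix.cons_val',
        Matrix.cons_val_zero, Matrix.cons_val_one, Matrix.cons_val_fin_one,
        _root_.map_one, mul_one, one_mul] at h
    · rw [hRs t ht] at h
      have h2 := h.div_unit S.nu_sqeps
      have h3 := hRR s hs t ht (by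
        convert h2 using 1
        field_simp
        ring)
      subst h3
      rfl
    · exact absurd h (hcross _ _ ((hR s hs).2.mul_int he0) (hTp t ht).sig)
    · rw [add_comm (_ * _), mul_comm] at h
      exact absurd h (hcross _ _ ((hR t ht).2.mul_int he0).sig (hTp s hs))
    · rw [hTs t ht] at h
      have h2 := h.div_nu hpe
      rw [add_sub_cancel_right] at h2
      have h3 := hTT s hs t ht (by
        convert h2 using 1
        field_simp
        ring)
      subst h3
      rfl

open Classical in
/-- The function supported on `Γ₀(p^n)`, equal to `theta` there. -/
def genFun (S : USetting E) (χ : E → ℂ) (n : ℤ) (k : Mat E) : ℂ :=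
  if k ∈ Gam S n then theta S χ k else 0

theorem genFun_mem_Vsp (hχ : IsChar χ) (hr : HasDepth S χ r) {n : ℤ} (hn : (r : ℤ) + 1 ≤ n) :
    genFun S χ n ∈ Vsp S χ n := by
  rw [mem_Vsp_iff hχ hr hn]
  refine ⟨fun x hx => if_neg fun h => hx h.1, fun m hm k _ => ?_⟩
  unfold genFun
  rw [mul_mem_Gam_iff hm]
  split_ifs with h
  · exact theta_mul hχ hr hn hm h
  · rw [mul_zero]

theorem genFun_mem_Hsp (hχ : IsChar χ) (hr : HasDepth S χ r) {n : ℤ} (hn : (r : ℤ) + 1 ≤ n) :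
    genFun S χ n ∈ Hsp S χ n := by
  refine ⟨genFun_mem_Vsp hχ hr hn, fun b hb => funext fun k => ?_⟩
  have hb' := Bcal_subset_Gam n hb
  rw [rho_apply, Pi.smul_apply, smul_eq_mul]
  unfold genFun
  rw [mul_mem_Gam_iff' hb']
  split_ifs with h
  · rw [theta_mul hχ hr hn h hb', mul_comm]
  · rw [mul_zero]

theorem eq_of_eq_on_reps {N : ℕ} {ι : Type} {x : ι → Mat E} (hx : ∀ i, x i ∈ Kset S)
    (hsurj : ∀ k ∈ Kset S, ∃ i, k * kinv S (x i) ∈ Gam S ((N : ℤ) + 1)) (hχ : IsChar χ) (hr : HasDepth S χ r)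
    (hN : r ≤ N) {f g : Mat E → ℂ} (hf : f ∈ Vsp S χ ((N : ℤ) + 1)) (hg : g ∈ Vsp S χ ((N : ℤ) + 1))
    (h : ∀ i, f (x i) = g (x i)) : f = g := by
  have hn : (r : ℤ) + 1 ≤ (N : ℤ) + 1 := by omega
  funext k
  by_cases hk : k ∈ Kset S
  · obtain ⟨i, hi⟩ := hsurj k hk
    have hki : k = k * kinv S (x i) * x i := by
      rw [Matrix.mul_assoc, kinv_mul_self (hx i), Matrix.mul_one]
    rw [hki, ((mem_Vsp_iff hχ hr hn).1 hf).2 _ hi _ (hx i),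
      ((mem_Vsp_iff hχ hr hn).1 hg).2 _ hi _ (hx i), h]
  · rw [hf.1 k hk, hg.1 k hk]

theorem sum_genFun_apply {N : ℕ} {ι : Type} [Fintype ι] {x : ι → Mat E}
    (hx : ∀ i, x i ∈ Kset S) (hinj : ∀ i j, x i * kinv S (x j) ∈ Gam S ((N : ℤ) + 1) → i = j)
    (hχ : IsChar χ) (c : ι → ℂ) (j : ι) :
    (∑ i, c i • rho (kinv S (x i)) (genFun S χ ((N : ℤ) + 1))) (x j) = c j := by
  rw [Finset.sum_apply, Finset.sum_eq_single j]
  · rw [Pi.smul_apply, rho_apply, mul_kinv_self (hx j), genFun, if_pos (one_mem_Gam _),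
      theta_one hχ, smul_eq_mul, mul_one]
  · intro i _ hij
    rw [Pi.smul_apply, rho_apply, genFun, if_neg fun h => hij (hinj _ _ h).symm, smul_zero]
  · intro h
    exact absurd (Finset.mem_univ j) h

theorem Vsp_le_of_genFun_mem (hχ : IsChar χ) (hr : HasDepth S χ r) {N : ℕ} (hN : r ≤ N)
    {U : Submodule ℂ (Mat E → ℂ)} (hU : KInvariant S U)
    (hgen : genFun S χ ((N : ℤ) + 1) ∈ U) : Vsp S χ ((N : ℤ) + 1) ≤ U := by
  intro f hf
  obtain ⟨ι, _, x, -, hx, hsurj, hinj⟩ := exists_coset_reps S N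
  have hn : (r : ℤ) + 1 ≤ (N : ℤ) + 1 := by omega
  have h : f = ∑ i, f (x i) • rho (kinv S (x i)) (genFun S χ ((N : ℤ) + 1)) :=
    eq_of_eq_on_reps hx hsurj hχ hr hN hf
      (Submodule.sum_mem _ fun i _ => Submodule.smul_mem _ _
        (KInvariant_Vsp _ _ (kinv_mem_Kset (hx i)) _ (genFun_mem_Vsp hχ hr hn)))
      fun i => (sum_genFun_apply hx hinj hχ (fun i => f (x i)) i).symm
  rw [h]
  exact Submodule.sum_mem _ fun i _ => Submodule.smul_mem _ _
    (hU _ (kinv_mem_Kset (hx i)) _ hgen)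

theorem finrank_Vsp (hχ : IsChar χ) (hr : HasDepth S χ r) {N : ℕ} (hN : r ≤ N) :
    FiniteDimensional ℂ (Vsp S χ ((N : ℤ) + 1)) ∧
      Module.finrank ℂ (Vsp S χ ((N : ℤ) + 1)) = (S.q + 1) * S.q ^ N := by
  obtain ⟨ι, _, x, hcard, hx, hsurj, hinj⟩ := exists_coset_reps S N
  have hn : (r : ℤ) + 1 ≤ (N : ℤ) + 1 := by omega
  let ev : Vsp S χ ((N : ℤ) + 1) →ₗ[ℂ] ι → ℂ :=
    (LinearMap.funLeft ℂ ℂ x).comp (Submodule.subtype _)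
  have hev : ∀ f i, ev f i = (f : Mat E → ℂ) (x i) := fun _ _ => rfl
  have hbij : Function.Bijective ev := by
    refine ⟨fun f g h => Subtype.ext (eq_of_eq_on_reps hx hsurj hχ hr hN f.2 g.2 fun i => ?_),
      fun c => ⟨⟨∑ i, c i • rho (kinv S (x i)) (genFun S χ ((N : ℤ) + 1)),
        Submodule.sum_mem _ fun i _ => Submodule.smul_mem _ _
          (KInvariant_Vsp _ _ (kinv_mem_Kset (hx i)) _ (genFun_mem_Vsp hχ hr hn))⟩, ?_⟩⟩
    · exact congrFun h i
    · funext i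
      exact sum_genFun_apply hx hinj hχ c i
  let e := LinearEquiv.ofBijective ev hbij
  exact ⟨e.symm.finiteDimensional, by rw [e.finrank_eq, Module.finrank_fintype_fun_eq_card, hcard]⟩

end Representatives

section Irreducibility

variable {S : USetting E} {χ : E → ℂ} {r : ℕ}

theorem KInvariant.sup {U W : Submodule ℂ (Mat E → ℂ)} (hU : KInvariant S U)
    (hW : KInvariant S W) : KInvariant S (U ⊔ W) := by
  intro g hg f hf
  obtain ⟨u, hu, w, hw, rfl⟩ := Submodule.mem_sup.1 hf
  rw [map_add]
  exact Submodule.add_mem_sup (hU g hg u hu) (hW g hg w hw)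

/-- Irreducibility of an invariant complement `W` of `V'` in `V_χ^{K_{N+1}}` when the
`χ`-eigenvectors of `𝓑` are at most one-dimensional modulo `V'`. -/
theorem eq_bot_or_eq_of_functional (hχ : IsChar χ) (hr : HasDepth S χ r) {N : ℕ} (hN : r ≤ N)
    {V' W U : Submodule ℂ (Mat E → ℂ)} (hV' : KInvariant S V') (hW : KInvariant S W)
    (hdisj : V' ⊓ W = ⊥) (hsup : V' ⊔ W = Vsp S χ ((N : ℤ) + 1))
    (l : (Mat E → ℂ) →ₗ[ℂ] ℂ) (hl : ∀ f ∈ Hsp S χ ((N : ℤ) + 1), l f = 0 → f ∈ V')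
    (hUW : U ≤ W) (hU : KInvariant S U) : U = ⊥ ∨ U = W := by
  have hn : (r : ℤ) + 1 ≤ (N : ℤ) + 1 := by omega
  have hcast : ((N + 1 : ℕ) : ℤ) = (N : ℤ) + 1 := by push_cast; ring
  have hWV : W ≤ Vsp S χ ((N : ℤ) + 1) := hsup ▸ le_sup_right
  have hV'V : V' ≤ Vsp S χ ((N : ℤ) + 1) := hsup ▸ le_sup_left
  have hzero : ∀ f, f ∈ V' → f ∈ W → f = 0 := fun f h1 h2 =>
    (Submodule.mem_bot ℂ).1 (hdisj ▸ Submodule.mem_inf.2 ⟨h1, h2⟩)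
  refine or_iff_not_imp_left.2 fun hne => ?_
  obtain ⟨f, hfU, hf0⟩ := Submodule.exists_mem_ne_zero_of_ne_bot hne
  obtain ⟨k, hk⟩ := Function.ne_iff.1 hf0
  have hkK : k ∈ Kset S := by
    by_contra h
    exact hk ((hWV (hUW hfU)).1 k h)
  obtain ⟨f', hf'U, hf'H, hf'0⟩ := exists_mem_Hsp hχ hr (n := N + 1) (by omega) hU
    (hcast ▸ hUW.trans hWV) (hU k hkK f hfU) (by rwa [rho_apply, Matrix.one_mul])
  rw [hcast] at hf'H
  have hlf' : l f' ≠ 0 := fun h => hf'0 (hzero f' (hl f' hf'H h) (hUW hf'U))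
  have hgen := genFun_mem_Hsp hχ hr hn
  obtain ⟨v, hv, w, hw, hvw⟩ := Submodule.mem_sup.1 (hsup ▸ hgen.1)
  have hwH : w ∈ Hsp S χ ((N : ℤ) + 1) := by
    refine ⟨hWV hw, fun b hb => sub_eq_zero.1 (hzero _ ?_ (W.sub_mem (hW b hb.1 w hw)
      (W.smul_mem _ hw)))⟩
    have h1 := hgen.2 b hb
    rw [← hvw, map_add, smul_add] at h1
    have h2 : rho b w - theta S χ b • w = -(rho b v - theta S χ b • v) := by
      linear_combination h1
    rw [h2]
    exact V'.neg_mem (V'.sub_mem (hV' b hb.1 v hv) (V'.smul_mem _ hv))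
  have hwU : w ∈ U := by
    have h1 : w - (l w / l f') • f' = 0 := by
      refine hzero _ (hl _ ⟨?_, fun b hb => ?_⟩ ?_) (W.sub_mem hw (W.smul_mem _ (hUW hf'U)))
      · exact Submodule.sub_mem _ hwH.1 (Submodule.smul_mem _ _ hf'H.1)
      · rw [map_sub, _root_.map_smul, hwH.2 b hb, hf'H.2 b hb, smul_sub, smul_comm]
      · rw [map_sub, _root_.map_smul, smul_eq_mul, div_mul_cancel₀ _ hlf', sub_self]
    rw [sub_eq_zero.1 h1]
    exact U.smul_mem _ hf'U
  have hle := Vsp_le_of_genFun_mem hχ hr hN (hV'.sup hU)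
    (hvw ▸ Submodule.add_mem_sup hv hwU)
  refine le_antisymm hUW fun g hg => ?_
  obtain ⟨v₁, hv₁, u, hu, hg'⟩ := Submodule.mem_sup.1 (hle (hWV hg))
  have h1 : v₁ = 0 := hzero v₁ hv₁ (by
    rw [← eq_sub_iff_add_eq] at hg'
    rw [hg']
    exact W.sub_mem hg (hUW hu))
  rwa [← hg', h1, zero_add]

end Irreducibility

section Assembly

variable {S : USetting E} {χ : E → ℂ} {r : ℕ}

theorem finrank_Wcompl (hχ : IsChar χ) (hr : HasDepth S χ r) {d : ℕ} (hd : r + 1 ≤ d)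
    {W : Submodule ℂ (Mat E → ℂ)} (hW : Wcompl S χ d W) :
    Module.finrank ℂ W = (S.q ^ 2 - 1) * S.q ^ (d - 1) := by
  obtain ⟨n, rfl⟩ : ∃ n, d = n + 1 := ⟨d - 1, by omega⟩
  obtain ⟨hle, -, hinf, hsup⟩ := hW
  obtain ⟨hfin, hrank⟩ := finrank_Vsp hχ hr (N := n + 1) (by omega)
  obtain ⟨hfin', hrank'⟩ := finrank_Vsp hχ hr (N := n) (by omega)
  rw [show ((n : ℤ) + 1) = ((n + 1 : ℕ) : ℤ) by push_cast; ring] at hfin' hrank'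
  have : FiniteDimensional ℂ W := Submodule.finiteDimensional_of_le hle
  have h := Submodule.finrank_sup_add_finrank_inf_eq (Vsp S χ ((n + 1 : ℕ) : ℤ)) W
  rw [hsup, hinf, finrank_bot, hrank, hrank', add_zero] at h
  obtain ⟨t, ht⟩ : ∃ t, S.q ^ 2 = t + 1 :=
    ⟨S.q ^ 2 - 1, by have := Nat.one_le_pow 2 S.q (by have := S.two_le_q; omega); omega⟩
  rw [ht, Nat.add_sub_cancel, Nat.add_sub_cancel]
  have h2 : (S.q + 1) * S.q ^ (n + 1) = (S.q + 1) * S.q ^ n + t * S.q ^ n := by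
    rw [pow_succ]
    linear_combination (S.q ^ n) * ht
  omega

theorem Wcompl.ne_bot (hχ : IsChar χ) (hr : HasDepth S χ r) {d : ℕ} (hd : r + 1 ≤ d)
    {W : Submodule ℂ (Mat E → ℂ)} (hW : Wcompl S χ d W) : W ≠ ⊥ := by
  rintro rfl
  have h := finrank_Wcompl hχ hr hd hW
  have hq := S.two_le_q
  have h2 : 2 ^ 2 ≤ S.q ^ 2 := Nat.pow_le_pow_left hq 2
  rw [finrank_bot] at h
  rcases mul_eq_zero.1 h.symm with h3 | h3
  · omega
  · exact absurd h3 (pow_ne_zero _ (by omega))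

theorem Wcompl.isIrredRep (hχ : IsChar χ) (hr : HasDepth S χ r) {d : ℕ} (hd : r + 1 ≤ d)
    {W : Submodule ℂ (Mat E → ℂ)} (hW : Wcompl S χ d W) : IsIrredRep S W := by
  refine ⟨hW.ne_bot hχ hr hd, hW.2.1, fun U hUW hU => ?_⟩
  have hy : S.sig (S.pi ^ d * S.sqeps) = -(S.pi ^ d * S.sqeps) := by
    rw [map_mul, map_pow, S.sig_pi, S.sig_sqeps, mul_neg]
  have hyd : S.nu (S.pi ^ d * S.sqeps) = ((d : ℤ) : WithTop ℤ) := by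
    rw [S.nu_mul, S.nu_pi_pow, S.nu_sqeps, add_zero]
  refine eq_bot_or_eq_of_functional hχ hr (N := d) (by omega) (KInvariant_Vsp _) hW.2.1 hW.2.2.1
    hW.2.2.2 (LinearMap.proj (R := ℂ) (φ := fun _ : Mat E => ℂ) 1 -
      LinearMap.proj (lowU (S.pi ^ d * S.sqeps))) (fun f hf h => ?_)
    hUW hU
  exact Hsp.mem_Vsp hχ hr (by exact_mod_cast hd) hf hy hyd (sub_eq_zero.1 h)

theorem Wcompl.not_actsTrivially (hχ : IsChar χ) (hr : HasDepth S χ r) {d : ℕ} (hd : r + 1 ≤ d)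
    {W : Submodule ℂ (Mat E → ℂ)} (hW : Wcompl S χ d W) :
    ¬ ActsTrivially S (Kfil S (d : ℤ)) W := by
  intro h
  refine hW.ne_bot hχ hr hd (eq_bot_iff.2 (hW.2.2.1 ▸ le_inf (fun f hf => ?_) le_rfl))
  have hf' := hW.1 hf
  exact ⟨hf'.1, hf'.2.1, fun k _ g hg => congrFun (h g hg f hf) k⟩

theorem isIrredRep_Vsp (hχ : IsChar χ) (hr : MinDepth S χ r)
    (hnt : ∃ x ∈ OFunits S, χ x ≠ 1) : IsIrredRep S (Vsp S χ ((r : ℤ) + 1)) := by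
  refine ⟨fun h => ?_, KInvariant_Vsp _, fun U hUW hU => ?_⟩
  · have h1 := (finrank_Vsp hχ hr.1 (le_refl r)).2
    have hq := S.two_le_q
    rw [h, finrank_bot] at h1
    rcases mul_eq_zero.1 h1.symm with h3 | h3
    · omega
    · exact absurd h3 (pow_ne_zero _ (by omega))
  · refine eq_bot_or_eq_of_functional hχ hr.1 (le_refl r) (V' := ⊥) (fun g _ f hf => ?_)
      (KInvariant_Vsp _) (bot_inf_eq _) (bot_sup_eq _) (LinearMap.proj 1) (fun f hf h => ?_) hUW hU
    · rw [(Submodule.mem_bot ℂ).1 hf, map_zero]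
      exact Submodule.zero_mem _
    · exact (Submodule.mem_bot ℂ).2 (Hsp.eq_zero hχ hr hnt hf h)

/-- Independence of a sequence of submodules, each disjoint from a bound for the previous ones. -/
theorem iSupIndep_of_disjoint_bound {R M : Type*} [Ring R] [AddCommGroup M] [Module R M]
    {Z B : ℕ → Submodule R M} (hZB : ∀ a b, b < a → Z b ≤ B a)
    (hB : ∀ a, Disjoint (B a) (Z a)) : iSupIndep Z := by
  rw [iSupIndep_iff_finsetSum_eq_zero_imp_eq_zero]
  intro s
  induction s using Finset.induction_on_max with
  | empty => simp
  | insert a s ha ih =>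
    intro v hv hsum
    have has : a ∉ s := fun h => lt_irrefl a (ha a h)
    rw [Finset.sum_insert has] at hsum
    have h1 : v a = 0 := by
      refine Submodule.disjoint_def.1 (hB a) _ ?_ (hv a (Finset.mem_insert_self a s))
      rw [eq_neg_of_add_eq_zero_left hsum]
      exact Submodule.neg_mem _ (Submodule.sum_mem _ fun i hi =>
        hZB a i (ha i hi) (hv i (Finset.mem_insert_of_mem hi)))
    rw [h1, zero_add] at hsum
    intro i hi
    rcases Finset.mem_insert.1 hi with rfl | hi
    · exact h1
    · exact ih v (fun j hj => hv j (Finset.mem_insert_of_mem hj)) hsum i hi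

theorem iSupIndep_Wcompl {W : ℕ → Submodule ℂ (Mat E → ℂ)}
    (hW : ∀ d : ℕ, r + 1 ≤ d → Wcompl S χ d (W d)) :
    iSupIndep (fun d : ℕ =>
      if d < r then ⊥ else if d = r then Vsp S χ ((r : ℤ) + 1) else W d) := by
  refine iSupIndep_of_disjoint_bound (B := fun a => if a ≤ r then ⊥ else Vsp S χ (a : ℤ))
    (fun a b hab => ?_) fun a => ?_
  · rcases lt_trichotomy b r with hb | rfl | hb
    · rw [if_pos hb]
      exact bot_le
    · rw [if_neg (lt_irrefl b), if_pos rfl, if_neg (by omega)]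
      exact Vsp_mono (by omega)
    · rw [if_neg (by omega), if_neg (by omega), if_neg (by omega)]
      exact (hW b hb).1.trans (Vsp_mono (by omega))
  · by_cases ha : a ≤ r
    · simp only [if_pos ha]
      exact disjoint_bot_left
    · simp only [if_neg ha, if_neg (show ¬ a < r by omega), if_neg (show ¬ a = r by omega)]
      exact disjoint_iff.2 (hW a (by omega)).2.2.1

theorem iSup_Vsp_eq {W : ℕ → Submodule ℂ (Mat E → ℂ)}
    (hW : ∀ d : ℕ, r + 1 ≤ d → Wcompl S χ d (W d)) :
    (⨆ n ∈ {n : ℕ | r + 1 ≤ n}, Vsp S χ (n : ℤ)) =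
      Vsp S χ ((r : ℤ) + 1) ⊔ ⨆ d ∈ {d : ℕ | r + 1 ≤ d}, W d := by
  have hcast : ∀ n : ℕ, Vsp S χ ((n + 1 : ℕ) : ℤ) = Vsp S χ ((n : ℤ) + 1) := fun n => by
    rw [Nat.cast_succ]
  refine le_antisymm (iSup₂_le fun n hn => ?_) (sup_le ?_ (iSup₂_le fun d hd => ?_))
  · induction n, (show r + 1 ≤ n from hn) using Nat.le_induction with
    | base =>
      rw [hcast]
      exact le_sup_left
    | succ n hrn ih =>
      rw [hcast, ← (hW n hrn).2.2.2]
      exact sup_le (ih hrn) (le_sup_of_le_right (le_biSup W hrn))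
  · exact le_iSup₂_of_le (r + 1) (le_refl (r + 1)) (hcast r).ge
  · exact (hW d hd).1.trans
      (le_iSup₂_of_le (d + 1) (Nat.le_succ_of_le hd) (hcast d).ge)

end Assembly

/-- for `χ` of minimal depth `r`, for every `d ≥ r+1` there is a `K`-invariant
complement `W_d` of `V_χ^{K_d}` in `V_χ^{K_{d+1}}`; every such `W_d` is irreducible of
dimension `(q²−1) q^{d−1}` with `K_{d+1}` acting trivially but not `K_d`; consequently
`⋃_{n ≥ r+1} V_χ^{K_n}` is the direct sum of `V_χ^{K_{r+1}}` and the `W_d`.  Moreover, if `χ`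
is nontrivial on `O_F^×`, then `V_χ^{K_{r+1}}` is irreducible of dimension `(q+1) q^r`. -/
theorem stmt9 (S : USetting E) (χ : E → ℂ) (hχ : IsChar χ) (r : ℕ)
    (hr : MinDepth S χ r) :
    (∀ d : ℕ, r + 1 ≤ d → ∃ W : Submodule ℂ (Mat E → ℂ), Wcompl S χ d W) ∧
    (∀ d : ℕ, r + 1 ≤ d → ∀ W : Submodule ℂ (Mat E → ℂ), Wcompl S χ d W →
      IsIrredRep S W ∧ Module.finrank ℂ ↥W = (S.q ^ 2 - 1) * S.q ^ (d - 1) ∧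
      ActsTrivially S (Kfil S ((d : ℤ) + 1)) W ∧ ¬ ActsTrivially S (Kfil S (d : ℤ)) W) ∧
    (∀ W : ℕ → Submodule ℂ (Mat E → ℂ), (∀ d : ℕ, r + 1 ≤ d → Wcompl S χ d (W d)) →
      iSupIndep (fun d : ℕ =>
        if d < r then ⊥ else if d = r then Vsp S χ ((r : ℤ) + 1) else W d) ∧
      (⨆ n ∈ {n : ℕ | r + 1 ≤ n}, Vsp S χ (n : ℤ)) =
        Vsp S χ ((r : ℤ) + 1) ⊔ ⨆ d ∈ {d : ℕ | r + 1 ≤ d}, W d) ∧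
    ((∃ x ∈ OFunits S, χ x ≠ 1) →
      IsIrredRep S (Vsp S χ ((r : ℤ) + 1)) ∧
      Module.finrank ℂ ↥(Vsp S χ ((r : ℤ) + 1)) = (S.q + 1) * S.q ^ r) := by
  refine ⟨fun d hd => exists_Wcompl hχ hr.1 hd, fun d hd W hW => ?_,
    fun W hW => ⟨iSupIndep_Wcompl hW, iSup_Vsp_eq hW⟩,
    fun hnt => ⟨isIrredRep_Vsp hχ hr hnt, (finrank_Vsp hχ hr.1 (le_refl r)).2⟩⟩
  exact ⟨hW.isIrredRep hχ hr.1 hd, finrank_Wcompl hχ hr.1 hd hW,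
    fun g hg f hf => rho_Kfil (hW.1 hf) hg, hW.not_actsTrivially hχ hr.1 hd⟩
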